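/- arXiv:1107.0951 — 2 statements merged into one kernel-verified Lean document; each statement's English description precedes it below -/
import Mathlib

section
/- For all n, r ≥ 1, the iterated twisting map of a braided Hopf crossed product datum satisfies χ_{n,r} = (ρ_{n,r}⊗id_{H^{⊗n}})∘(id_{H^{⊗n}}⊗𝔰_{n,r})∘(Δ_{H^{⊗_c n}}⊗id_{A^{⊗r}}) as maps H^{⊗n}⊗A^{⊗r} → A^{⊗r}⊗H^{⊗n}. -/
/-!
For all `n, r ≥ 1`, the iterated twisting map of a braided Hopf crossed product datum
satisfies `χ_{n,r} = (ρ_{n,r}⊗id_{H^{⊗n}})∘(id_{H^{⊗n}}⊗𝔰_{n,r})∘(Δ_{H^{⊗_c n}}⊗id_{A^{⊗r}})`.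
(Here `pw k H n` denotes `H^{⊗(n+1)}`, so the statement below, quantified over all
`n r : ℕ`, covers exactly all `n, r ≥ 1`.)
-/

open scoped TensorProduct

universe u

variable (k : Type u) [Field k]

/-- A bundled `k`-vector space. -/
structure VS (k : Type u) [Field k] : Type (u + 1) where
  /-- underlying type -/
  carrier : Type u
  [acg : AddCommGroup carrier]
  [mod : Module k carrier]

attribute [instance] VS.acg VS.mod

instance : CoeSort (VS k) (Type u) := ⟨VS.carrier⟩

/-- Iterated tensor powers: `pw k M n` is `M^{⊗(n+1)}`, right-nested. -/
noncomputable def pw (M : Type u) [AddCommGroup M] [Module k M] : ℕ → VS k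
  | 0 => ⟨M⟩
  | n + 1 => ⟨M ⊗[k] ↥(pw M n)⟩

variable {M : Type u} [AddCommGroup M] [Module k M]

/-- The canonical identification `M^{⊗(n+1)} ⊗ M ≅ M^{⊗(n+2)}`. -/
noncomputable def snoc : ∀ n : ℕ, (↥(pw k M n) ⊗[k] M) ≃ₗ[k] ↥(pw k M (n + 1))
  | 0 => LinearEquiv.refl k (M ⊗[k] M)
  | n + 1 =>
      (TensorProduct.assoc k M ↥(pw k M n) M) ≪≫ₗ
        TensorProduct.congr (LinearEquiv.refl k M) (snoc n)

section Twist

variable {Hh Aa : Type u} [AddCommGroup Hh] [Module k Hh] [AddCommGroup Aa] [Module k Aa]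
variable {k}

/-- `t_{1,l}` : the extension of a twisting-type map `t : Hh⊗Aa → Aa⊗Hh` to
`Hh ⊗ Aa^{⊗(l+1)} → Aa^{⊗(l+1)} ⊗ Hh`, via `t_{1,l+1} := (id_{Aa^{⊗l}}⊗t)∘(t_{1,l}⊗id_{Aa})`. -/
noncomputable def tw1 (t : Hh ⊗[k] Aa →ₗ[k] Aa ⊗[k] Hh) :
    ∀ l : ℕ, (Hh ⊗[k] ↥(pw k Aa l)) →ₗ[k] (↥(pw k Aa l) ⊗[k] Hh)
  | 0 => t
  | l + 1 =>
      LinearMap.rTensor Hh (snoc k l).toLinearMap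
        ∘ₗ (TensorProduct.assoc k ↥(pw k Aa l) Aa Hh).symm.toLinearMap
        ∘ₗ LinearMap.lTensor ↥(pw k Aa l) t
        ∘ₗ (TensorProduct.assoc k ↥(pw k Aa l) Hh Aa).toLinearMap
        ∘ₗ LinearMap.rTensor Aa (tw1 t l)
        ∘ₗ (TensorProduct.assoc k Hh ↥(pw k Aa l) Aa).symm.toLinearMap
        ∘ₗ LinearMap.lTensor Hh (snoc k l).symm.toLinearMap

/-- `t_{j,l}` : the extension of `t` to `Hh^{⊗(j+1)} ⊗ Aa^{⊗(l+1)} → Aa^{⊗(l+1)} ⊗ Hh^{⊗(j+1)}`,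
via `t_{j+1,l} := (t_{1,l}⊗id_{Hh^{⊗j}})∘(id_{Hh}⊗t_{j,l})`. -/
noncomputable def twFull (t : Hh ⊗[k] Aa →ₗ[k] Aa ⊗[k] Hh) :
    ∀ (j l : ℕ), (↥(pw k Hh j) ⊗[k] ↥(pw k Aa l)) →ₗ[k] (↥(pw k Aa l) ⊗[k] ↥(pw k Hh j))
  | 0, l => tw1 t l
  | j + 1, l =>
      (TensorProduct.assoc k ↥(pw k Aa l) Hh ↥(pw k Hh j)).toLinearMap
        ∘ₗ LinearMap.rTensor ↥(pw k Hh j) (tw1 t l)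
        ∘ₗ (TensorProduct.assoc k Hh ↥(pw k Aa l) ↥(pw k Hh j)).symm.toLinearMap
        ∘ₗ LinearMap.lTensor Hh (twFull t j l)
        ∘ₗ (TensorProduct.assoc k Hh ↥(pw k Hh j) ↥(pw k Aa l)).toLinearMap

/-- The bijective version of `tw1`, for a bijective `t`. -/
noncomputable def twE1 (t : Hh ⊗[k] Aa ≃ₗ[k] Aa ⊗[k] Hh) :
    ∀ l : ℕ, (Hh ⊗[k] ↥(pw k Aa l)) ≃ₗ[k] (↥(pw k Aa l) ⊗[k] Hh)
  | 0 => t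
  | l + 1 =>
      TensorProduct.congr (LinearEquiv.refl k Hh) (snoc k l).symm
        ≪≫ₗ (TensorProduct.assoc k Hh ↥(pw k Aa l) Aa).symm
        ≪≫ₗ TensorProduct.congr (twE1 t l) (LinearEquiv.refl k Aa)
        ≪≫ₗ TensorProduct.assoc k ↥(pw k Aa l) Hh Aa
        ≪≫ₗ TensorProduct.congr (LinearEquiv.refl k ↥(pw k Aa l)) t
        ≪≫ₗ (TensorProduct.assoc k ↥(pw k Aa l) Aa Hh).symm
        ≪≫ₗ TensorProduct.congr (snoc k l) (LinearEquiv.refl k Hh)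

/-- The bijective version of `twFull`, for a bijective `t`. -/
noncomputable def twEFull (t : Hh ⊗[k] Aa ≃ₗ[k] Aa ⊗[k] Hh) :
    ∀ (j l : ℕ), (↥(pw k Hh j) ⊗[k] ↥(pw k Aa l)) ≃ₗ[k] (↥(pw k Aa l) ⊗[k] ↥(pw k Hh j))
  | 0, l => twE1 t l
  | j + 1, l =>
      TensorProduct.assoc k Hh ↥(pw k Hh j) ↥(pw k Aa l)
        ≪≫ₗ TensorProduct.congr (LinearEquiv.refl k Hh) (twEFull t j l)
        ≪≫ₗ (TensorProduct.assoc k Hh ↥(pw k Aa l) ↥(pw k Hh j)).symm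
        ≪≫ₗ TensorProduct.congr (twE1 t l) (LinearEquiv.refl k ↥(pw k Hh j))
        ≪≫ₗ TensorProduct.assoc k ↥(pw k Aa l) Hh ↥(pw k Hh j)

end Twist

section Action

variable {Hh Aa : Type u} [AddCommGroup Hh] [Module k Hh] [AddCommGroup Aa] [Module k Aa]
variable {k}

/-- `ρ_l` : the extension `ρ_{l+1} := (ρ_l⊗ρ)∘(id_{Hh}⊗𝔰_{1,l}⊗id_{Aa})∘(Δ⊗id)` of a weak
action `ρ` to `Hh ⊗ Aa^{⊗(l+1)} → Aa^{⊗(l+1)}`. -/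
noncomputable def rhoPow (Δ : Hh →ₗ[k] Hh ⊗[k] Hh) (s : Hh ⊗[k] Aa ≃ₗ[k] Aa ⊗[k] Hh)
    (ρ : Hh ⊗[k] Aa →ₗ[k] Aa) :
    ∀ l : ℕ, (Hh ⊗[k] ↥(pw k Aa l)) →ₗ[k] ↥(pw k Aa l)
  | 0 => ρ
  | l + 1 =>
      (snoc k l).toLinearMap
        ∘ₗ TensorProduct.map (rhoPow Δ s ρ l) ρ
        ∘ₗ (TensorProduct.assoc k Hh ↥(pw k Aa l) (Hh ⊗[k] Aa)).symm.toLinearMap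
        ∘ₗ LinearMap.lTensor Hh (TensorProduct.assoc k ↥(pw k Aa l) Hh Aa).toLinearMap
        ∘ₗ LinearMap.lTensor Hh (LinearMap.rTensor Aa (twE1 s l).toLinearMap)
        ∘ₗ LinearMap.lTensor Hh (TensorProduct.assoc k Hh ↥(pw k Aa l) Aa).symm.toLinearMap
        ∘ₗ (TensorProduct.assoc k Hh Hh (↥(pw k Aa l) ⊗[k] Aa)).toLinearMap
        ∘ₗ LinearMap.rTensor (↥(pw k Aa l) ⊗[k] Aa) Δ
        ∘ₗ LinearMap.lTensor Hh (snoc k l).symm.toLinearMap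

/-- `ρ_{j,l}` : the extension `ρ_{j+1,l} := ρ_{1,l}∘(id_{Hh}⊗ρ_{j,l})`. -/
noncomputable def rhoFull (Δ : Hh →ₗ[k] Hh ⊗[k] Hh) (s : Hh ⊗[k] Aa ≃ₗ[k] Aa ⊗[k] Hh)
    (ρ : Hh ⊗[k] Aa →ₗ[k] Aa) :
    ∀ (j l : ℕ), (↥(pw k Hh j) ⊗[k] ↥(pw k Aa l)) →ₗ[k] ↥(pw k Aa l)
  | 0, l => rhoPow Δ s ρ l
  | j + 1, l =>
      rhoPow Δ s ρ l
        ∘ₗ LinearMap.lTensor Hh (rhoFull Δ s ρ j l)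
        ∘ₗ (TensorProduct.assoc k Hh ↥(pw k Hh j) ↥(pw k Aa l)).toLinearMap

end Action

section ComulPow

variable {Hh : Type u} [AddCommGroup Hh] [Module k Hh]
variable {k}

/-- `Δ^{⊗(n+1)} : Hh^{⊗(n+1)} → (Hh⊗Hh)^{⊗(n+1)}`. -/
noncomputable def dPow (Δ : Hh →ₗ[k] Hh ⊗[k] Hh) :
    ∀ n : ℕ, ↥(pw k Hh n) →ₗ[k] ↥(pw k (Hh ⊗[k] Hh) n)
  | 0 => Δ
  | n + 1 => TensorProduct.map Δ (dPow Δ n)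

/-- `id_{Hh} ⊗ c^{×(n+1)} ⊗ id_{Hh}` : the simultaneous application of `c` to the `n+1`
consecutive interior pairs of tensor factors of `(Hh⊗Hh)^{⊗(n+2)}`. -/
noncomputable def mids (c : Hh ⊗[k] Hh →ₗ[k] Hh ⊗[k] Hh) :
    ∀ n : ℕ, ↥(pw k (Hh ⊗[k] Hh) (n + 1)) →ₗ[k] (Hh ⊗[k] (↥(pw k (Hh ⊗[k] Hh) n) ⊗[k] Hh))
  | 0 =>
      LinearMap.lTensor Hh (LinearMap.rTensor Hh c)
        ∘ₗ LinearMap.lTensor Hh (TensorProduct.assoc k Hh Hh Hh).symm.toLinearMap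
        ∘ₗ (TensorProduct.assoc k Hh Hh (Hh ⊗[k] Hh)).toLinearMap
  | n + 1 =>
      LinearMap.lTensor Hh
          (TensorProduct.assoc k (Hh ⊗[k] Hh) ↥(pw k (Hh ⊗[k] Hh) n) Hh).symm.toLinearMap
        ∘ₗ LinearMap.lTensor Hh (LinearMap.rTensor (↥(pw k (Hh ⊗[k] Hh) n) ⊗[k] Hh) c)
        ∘ₗ LinearMap.lTensor Hh
            (TensorProduct.assoc k Hh Hh (↥(pw k (Hh ⊗[k] Hh) n) ⊗[k] Hh)).symm.toLinearMap
        ∘ₗ (TensorProduct.assoc k Hh Hh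
            (Hh ⊗[k] (↥(pw k (Hh ⊗[k] Hh) n) ⊗[k] Hh))).toLinearMap
        ∘ₗ LinearMap.lTensor (Hh ⊗[k] Hh) (mids c n)

/-- `𝔠_{n+1}` (composed with the regrouping `Hh^{⊗2(n+1)} ≅ Hh^{⊗(n+1)}⊗Hh^{⊗(n+1)}`) :
defined by `𝔠_1 = id` and `𝔠_{n+1} = (id⊗𝔠_n⊗id)∘(id⊗c^{×n}⊗id)`. -/
noncomputable def cShuffle (c : Hh ⊗[k] Hh →ₗ[k] Hh ⊗[k] Hh) :
    ∀ n : ℕ, ↥(pw k (Hh ⊗[k] Hh) n) →ₗ[k] (↥(pw k Hh n) ⊗[k] ↥(pw k Hh n))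
  | 0 => LinearMap.id
  | n + 1 =>
      (TensorProduct.assoc k Hh ↥(pw k Hh n) ↥(pw k Hh (n + 1))).symm.toLinearMap
        ∘ₗ LinearMap.lTensor Hh (LinearMap.lTensor ↥(pw k Hh n) (snoc k n).toLinearMap)
        ∘ₗ LinearMap.lTensor Hh (TensorProduct.assoc k ↥(pw k Hh n) ↥(pw k Hh n) Hh).toLinearMap
        ∘ₗ LinearMap.lTensor Hh (LinearMap.rTensor Hh (cShuffle c n))
        ∘ₗ mids c n

/-- The comultiplication `Δ_{H^{⊗_c(n+1)}} := 𝔠_{n+1}∘Δ^{⊗(n+1)}` of the braided tensor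
power coalgebra. -/
noncomputable def comulP (c : Hh ⊗[k] Hh →ₗ[k] Hh ⊗[k] Hh) (Δ : Hh →ₗ[k] Hh ⊗[k] Hh)
    (n : ℕ) : ↥(pw k Hh n) →ₗ[k] (↥(pw k Hh n) ⊗[k] ↥(pw k Hh n)) :=
  cShuffle c n ∘ₗ dPow Δ n

/-- The counit `ε^{⊗(n+1)}` of the braided tensor power coalgebra. -/
noncomputable def counitP (ε : Hh →ₗ[k] k) : ∀ n : ℕ, ↥(pw k Hh n) →ₗ[k] k
  | 0 => ε
  | n + 1 => (TensorProduct.lid k k).toLinearMap ∘ₗ TensorProduct.map ε (counitP ε n)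

end ComulPow

/-- A braided bialgebra: an algebra-and-coalgebra `H` together with a bijective braiding
operator `c` compatible with both structures, for which `η` is a coalgebra morphism, `ε` is
an algebra morphism and `Δ∘μ = (μ⊗μ)∘(id⊗c⊗id)∘(Δ⊗Δ)`. -/
structure BraidedBialgebra (H : Type u) [Ring H] [Algebra k H] [Coalgebra k H] where
  /-- the braid -/
  c : H ⊗[k] H ≃ₗ[k] H ⊗[k] H
  /-- `(c⊗id)∘(id⊗c)∘(c⊗id) = (id⊗c)∘(c⊗id)∘(id⊗c)` -/
  yang_baxter :
    LinearMap.rTensor H c.toLinearMap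
        ∘ₗ (TensorProduct.assoc k H H H).symm.toLinearMap
        ∘ₗ LinearMap.lTensor H c.toLinearMap
        ∘ₗ (TensorProduct.assoc k H H H).toLinearMap
        ∘ₗ LinearMap.rTensor H c.toLinearMap
      = (TensorProduct.assoc k H H H).symm.toLinearMap
        ∘ₗ LinearMap.lTensor H c.toLinearMap
        ∘ₗ (TensorProduct.assoc k H H H).toLinearMap
        ∘ₗ LinearMap.rTensor H c.toLinearMap
        ∘ₗ (TensorProduct.assoc k H H H).symm.toLinearMap
        ∘ₗ LinearMap.lTensor H c.toLinearMap
        ∘ₗ (TensorProduct.assoc k H H H).toLinearMap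
  /-- `c(h⊗1) = 1⊗h` -/
  braid_one_right : ∀ h : H, c (h ⊗ₜ[k] (1 : H)) = (1 : H) ⊗ₜ[k] h
  /-- `c(1⊗h) = h⊗1` -/
  braid_one_left : ∀ h : H, c ((1 : H) ⊗ₜ[k] h) = h ⊗ₜ[k] (1 : H)
  /-- `c∘(μ⊗id) = (id⊗μ)∘(c⊗id)∘(id⊗c)` -/
  braid_mul_right :
    c.toLinearMap ∘ₗ LinearMap.rTensor H (LinearMap.mul' k H)
      = LinearMap.lTensor H (LinearMap.mul' k H)
        ∘ₗ (TensorProduct.assoc k H H H).toLinearMap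
        ∘ₗ LinearMap.rTensor H c.toLinearMap
        ∘ₗ (TensorProduct.assoc k H H H).symm.toLinearMap
        ∘ₗ LinearMap.lTensor H c.toLinearMap
        ∘ₗ (TensorProduct.assoc k H H H).toLinearMap
  /-- `c∘(id⊗μ) = (μ⊗id)∘(id⊗c)∘(c⊗id)` -/
  braid_mul_left :
    c.toLinearMap ∘ₗ LinearMap.lTensor H (LinearMap.mul' k H)
      = LinearMap.rTensor H (LinearMap.mul' k H)
        ∘ₗ (TensorProduct.assoc k H H H).symm.toLinearMap
        ∘ₗ LinearMap.lTensor H c.toLinearMap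
        ∘ₗ (TensorProduct.assoc k H H H).toLinearMap
        ∘ₗ LinearMap.rTensor H c.toLinearMap
        ∘ₗ (TensorProduct.assoc k H H H).symm.toLinearMap
  /-- `(id⊗ε)∘c = ε⊗id` -/
  braid_counit_right :
    (TensorProduct.rid k H).toLinearMap
        ∘ₗ LinearMap.lTensor H (Coalgebra.counit (R := k) (A := H))
        ∘ₗ c.toLinearMap
      = (TensorProduct.lid k H).toLinearMap
        ∘ₗ LinearMap.rTensor H (Coalgebra.counit (R := k) (A := H))
  /-- `(ε⊗id)∘c = id⊗ε` -/
  braid_counit_left :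
    (TensorProduct.lid k H).toLinearMap
        ∘ₗ LinearMap.rTensor H (Coalgebra.counit (R := k) (A := H))
        ∘ₗ c.toLinearMap
      = (TensorProduct.rid k H).toLinearMap
        ∘ₗ LinearMap.lTensor H (Coalgebra.counit (R := k) (A := H))
  /-- `(id⊗Δ)∘c = (c⊗id)∘(id⊗c)∘(Δ⊗id)` -/
  braid_comul_right :
    LinearMap.lTensor H (Coalgebra.comul (R := k) (A := H)) ∘ₗ c.toLinearMap
      = (TensorProduct.assoc k H H H).toLinearMap
        ∘ₗ LinearMap.rTensor H c.toLinearMap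
        ∘ₗ (TensorProduct.assoc k H H H).symm.toLinearMap
        ∘ₗ LinearMap.lTensor H c.toLinearMap
        ∘ₗ (TensorProduct.assoc k H H H).toLinearMap
        ∘ₗ LinearMap.rTensor H (Coalgebra.comul (R := k) (A := H))
  /-- `(Δ⊗id)∘c = (id⊗c)∘(c⊗id)∘(id⊗Δ)` -/
  braid_comul_left :
    (TensorProduct.assoc k H H H).toLinearMap
        ∘ₗ LinearMap.rTensor H (Coalgebra.comul (R := k) (A := H))
        ∘ₗ c.toLinearMap
      = LinearMap.lTensor H c.toLinearMap
        ∘ₗ (TensorProduct.assoc k H H H).toLinearMap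
        ∘ₗ LinearMap.rTensor H c.toLinearMap
        ∘ₗ (TensorProduct.assoc k H H H).symm.toLinearMap
        ∘ₗ LinearMap.lTensor H (Coalgebra.comul (R := k) (A := H))
  /-- `Δ(1) = 1⊗1` -/
  comul_one : Coalgebra.comul (R := k) (1 : H) = (1 : H) ⊗ₜ[k] (1 : H)
  /-- `ε(1) = 1` -/
  counit_one : Coalgebra.counit (R := k) (1 : H) = (1 : k)
  /-- `ε(hl) = ε(h)ε(l)` -/
  counit_mul : ∀ h l : H,
    Coalgebra.counit (R := k) (h * l)
      = Coalgebra.counit (R := k) h * Coalgebra.counit (R := k) l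
  /-- `Δ∘μ = (μ⊗μ)∘(id⊗c⊗id)∘(Δ⊗Δ)` -/
  comul_mul :
    (Coalgebra.comul (R := k) (A := H)) ∘ₗ LinearMap.mul' k H
      = TensorProduct.map (LinearMap.mul' k H) (LinearMap.mul' k H)
        ∘ₗ (TensorProduct.assoc k H H (H ⊗[k] H)).symm.toLinearMap
        ∘ₗ LinearMap.lTensor H (TensorProduct.assoc k H H H).toLinearMap
        ∘ₗ LinearMap.lTensor H (LinearMap.rTensor H c.toLinearMap)
        ∘ₗ LinearMap.lTensor H (TensorProduct.assoc k H H H).symm.toLinearMap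
        ∘ₗ (TensorProduct.assoc k H H (H ⊗[k] H)).toLinearMap
        ∘ₗ TensorProduct.map (Coalgebra.comul (R := k) (A := H))
            (Coalgebra.comul (R := k) (A := H))

/-- A transposition of the braided bialgebra `(H, c)` on the algebra `A`: a bijective
twisting map `s : H⊗A → A⊗H` compatible with the bialgebra structure of `H`. -/
structure Transposition {H : Type u} [Ring H] [Algebra k H] [Coalgebra k H]
    (c : H ⊗[k] H ≃ₗ[k] H ⊗[k] H) (A : Type u) [Ring A] [Algebra k A] where
  /-- the underlying bijective linear map -/
  s : H ⊗[k] A ≃ₗ[k] A ⊗[k] H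
  /-- `s(h⊗1_A) = 1_A⊗h` -/
  s_one_right : ∀ h : H, s (h ⊗ₜ[k] (1 : A)) = (1 : A) ⊗ₜ[k] h
  /-- `s(1_H⊗a) = a⊗1_H` -/
  s_one_left : ∀ a : A, s ((1 : H) ⊗ₜ[k] a) = a ⊗ₜ[k] (1 : H)
  /-- `s∘(id_H⊗μ_A) = (μ_A⊗id_H)∘(id_A⊗s)∘(s⊗id_A)` -/
  s_mul_A :
    s.toLinearMap ∘ₗ LinearMap.lTensor H (LinearMap.mul' k A)
      = LinearMap.rTensor H (LinearMap.mul' k A)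
        ∘ₗ (TensorProduct.assoc k A A H).symm.toLinearMap
        ∘ₗ LinearMap.lTensor A s.toLinearMap
        ∘ₗ (TensorProduct.assoc k A H A).toLinearMap
        ∘ₗ LinearMap.rTensor A s.toLinearMap
        ∘ₗ (TensorProduct.assoc k H A A).symm.toLinearMap
  /-- `s∘(μ_H⊗id_A) = (id_A⊗μ_H)∘(s⊗id_H)∘(id_H⊗s)` -/
  s_mul_H :
    s.toLinearMap ∘ₗ LinearMap.rTensor A (LinearMap.mul' k H)
      = LinearMap.lTensor A (LinearMap.mul' k H)
        ∘ₗ (TensorProduct.assoc k A H H).toLinearMap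
        ∘ₗ LinearMap.rTensor H s.toLinearMap
        ∘ₗ (TensorProduct.assoc k H A H).symm.toLinearMap
        ∘ₗ LinearMap.lTensor H s.toLinearMap
        ∘ₗ (TensorProduct.assoc k H H A).toLinearMap
  /-- `(id_A⊗ε_H)∘s = ε_H⊗id_A` -/
  s_counit :
    (TensorProduct.rid k A).toLinearMap
        ∘ₗ LinearMap.lTensor A (Coalgebra.counit (R := k) (A := H))
        ∘ₗ s.toLinearMap
      = (TensorProduct.lid k A).toLinearMap
        ∘ₗ LinearMap.rTensor A (Coalgebra.counit (R := k) (A := H))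
  /-- `(id_A⊗Δ_H)∘s = (s⊗id_H)∘(id_H⊗s)∘(Δ_H⊗id_A)` -/
  s_comul :
    LinearMap.lTensor A (Coalgebra.comul (R := k) (A := H)) ∘ₗ s.toLinearMap
      = (TensorProduct.assoc k A H H).toLinearMap
        ∘ₗ LinearMap.rTensor H s.toLinearMap
        ∘ₗ (TensorProduct.assoc k H A H).symm.toLinearMap
        ∘ₗ LinearMap.lTensor H s.toLinearMap
        ∘ₗ (TensorProduct.assoc k H H A).toLinearMap
        ∘ₗ LinearMap.rTensor A (Coalgebra.comul (R := k) (A := H))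
  /-- `(s⊗id_H)∘(id_H⊗s)∘(c⊗id_A) = (id_A⊗c)∘(s⊗id_H)∘(id_H⊗s)` -/
  s_braid :
    (TensorProduct.assoc k A H H).toLinearMap
        ∘ₗ LinearMap.rTensor H s.toLinearMap
        ∘ₗ (TensorProduct.assoc k H A H).symm.toLinearMap
        ∘ₗ LinearMap.lTensor H s.toLinearMap
        ∘ₗ (TensorProduct.assoc k H H A).toLinearMap
        ∘ₗ LinearMap.rTensor A c.toLinearMap
      = LinearMap.lTensor A c.toLinearMap
        ∘ₗ (TensorProduct.assoc k A H H).toLinearMap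
        ∘ₗ LinearMap.rTensor H s.toLinearMap
        ∘ₗ (TensorProduct.assoc k H A H).symm.toLinearMap
        ∘ₗ LinearMap.lTensor H s.toLinearMap
        ∘ₗ (TensorProduct.assoc k H H A).toLinearMap

/-- A weak `s`-action of the braided bialgebra `(H, c)` on the algebra `A`. -/
structure WeakSAction {H A : Type u} [Ring H] [Algebra k H] [Coalgebra k H]
    [Ring A] [Algebra k A]
    (c : H ⊗[k] H ≃ₗ[k] H ⊗[k] H) (s : H ⊗[k] A ≃ₗ[k] A ⊗[k] H) where
  /-- the action map -/
  ρ : H ⊗[k] A →ₗ[k] A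
  /-- `ρ∘(id_H⊗μ_A) = μ_A∘(ρ⊗ρ)∘(id_H⊗s⊗id_A)∘(Δ_H⊗id_{A⊗A})` -/
  rho_mul :
    ρ ∘ₗ LinearMap.lTensor H (LinearMap.mul' k A)
      = LinearMap.mul' k A
        ∘ₗ TensorProduct.map ρ ρ
        ∘ₗ (TensorProduct.assoc k H A (H ⊗[k] A)).symm.toLinearMap
        ∘ₗ LinearMap.lTensor H (TensorProduct.assoc k A H A).toLinearMap
        ∘ₗ LinearMap.lTensor H (LinearMap.rTensor A s.toLinearMap)
        ∘ₗ LinearMap.lTensor H (TensorProduct.assoc k H A A).symm.toLinearMap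
        ∘ₗ (TensorProduct.assoc k H H (A ⊗[k] A)).toLinearMap
        ∘ₗ LinearMap.rTensor (A ⊗[k] A) (Coalgebra.comul (R := k) (A := H))
  /-- `ρ(h⊗1_A) = ε(h)1_A` -/
  rho_one : ∀ h : H, ρ (h ⊗ₜ[k] (1 : A)) = Coalgebra.counit (R := k) h • (1 : A)
  /-- `ρ(1_H⊗a) = a` -/
  one_rho : ∀ a : A, ρ ((1 : H) ⊗ₜ[k] a) = a
  /-- `s∘(id_H⊗ρ) = (ρ⊗id_H)∘(id_H⊗s)∘(c⊗id_A)` -/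
  rho_s :
    s.toLinearMap ∘ₗ LinearMap.lTensor H ρ
      = LinearMap.rTensor H ρ
        ∘ₗ (TensorProduct.assoc k H A H).symm.toLinearMap
        ∘ₗ LinearMap.lTensor H s.toLinearMap
        ∘ₗ (TensorProduct.assoc k H H A).toLinearMap
        ∘ₗ LinearMap.rTensor A c.toLinearMap
        ∘ₗ (TensorProduct.assoc k H H A).symm.toLinearMap

variable {k}

/-- The twisting map `χ := (ρ⊗id_H)∘(id_H⊗s)∘(Δ_H⊗id_A)` associated with a braided
Hopf crossed product datum. -/
noncomputable def chi {H A : Type u} [Ring H] [Algebra k H] [Coalgebra k H]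
    [Ring A] [Algebra k A]
    (s : H ⊗[k] A →ₗ[k] A ⊗[k] H) (ρ : H ⊗[k] A →ₗ[k] A) :
    H ⊗[k] A →ₗ[k] A ⊗[k] H :=
  LinearMap.rTensor H ρ
    ∘ₗ (TensorProduct.assoc k H A H).symm.toLinearMap
    ∘ₗ LinearMap.lTensor H s
    ∘ₗ (TensorProduct.assoc k H H A).toLinearMap
    ∘ₗ LinearMap.rTensor A (Coalgebra.comul (R := k) (A := H))


section Legs

variable {R : Type*} [CommSemiring R]
variable {X Y Z X' Y' Z' C D : Type*}
  [AddCommMonoid X] [AddCommMonoid Y] [AddCommMonoid Z] [AddCommMonoid X'] [AddCommMonoid Y']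
  [AddCommMonoid Z'] [AddCommMonoid C] [AddCommMonoid D]
  [Module R X] [Module R Y] [Module R Z] [Module R X'] [Module R Y'] [Module R Z']
  [Module R C] [Module R D]

/-- `f : X⊗Y → X'⊗Y'` acting on the first two factors of the right-nested `X⊗(Y⊗C)`. -/
noncomputable def legs22 (C : Type*) [AddCommMonoid C] [Module R C]
    (f : X ⊗[R] Y →ₗ[R] X' ⊗[R] Y') : X ⊗[R] (Y ⊗[R] C) →ₗ[R] X' ⊗[R] (Y' ⊗[R] C) :=
  (TensorProduct.assoc R X' Y' C).toLinearMap
    ∘ₗ LinearMap.rTensor C f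
    ∘ₗ (TensorProduct.assoc R X Y C).symm.toLinearMap

/-- `f : X⊗Y → Z` acting on the first two factors of the right-nested `X⊗(Y⊗C)`. -/
noncomputable def legs21 (C : Type*) [AddCommMonoid C] [Module R C]
    (f : X ⊗[R] Y →ₗ[R] Z) : X ⊗[R] (Y ⊗[R] C) →ₗ[R] Z ⊗[R] C :=
  LinearMap.rTensor C f ∘ₗ (TensorProduct.assoc R X Y C).symm.toLinearMap

/-- `f : Z → X⊗Y` acting on the first factor of `Z⊗C`, with right-nested codomain. -/
noncomputable def legs12 (C : Type*) [AddCommMonoid C] [Module R C]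
    (f : Z →ₗ[R] X ⊗[R] Y) : Z ⊗[R] C →ₗ[R] X ⊗[R] (Y ⊗[R] C) :=
  (TensorProduct.assoc R X Y C).toLinearMap ∘ₗ LinearMap.rTensor C f

@[simp] theorem legs22_tmul (f : X ⊗[R] Y →ₗ[R] X' ⊗[R] Y') (x : X) (y : Y) (c : C) :
    legs22 C f (x ⊗ₜ (y ⊗ₜ c)) = TensorProduct.assoc R X' Y' C (f (x ⊗ₜ y) ⊗ₜ c) := rfl

@[simp] theorem legs21_tmul (f : X ⊗[R] Y →ₗ[R] Z) (x : X) (y : Y) (c : C) :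
    legs21 C f (x ⊗ₜ (y ⊗ₜ c)) = f (x ⊗ₜ y) ⊗ₜ c := rfl

@[simp] theorem legs12_tmul (f : Z →ₗ[R] X ⊗[R] Y) (z : Z) (c : C) :
    legs12 C f (z ⊗ₜ c) = TensorProduct.assoc R X Y C (f z ⊗ₜ c) := rfl

theorem assoc_lTensor (g : C →ₗ[R] D) (x : (X ⊗[R] Y) ⊗[R] C) :
    TensorProduct.assoc R X Y D (g.lTensor (X ⊗[R] Y) x)
      = (g.lTensor Y).lTensor X (TensorProduct.assoc R X Y C x) := by
  refine LinearMap.congr_fun (f := (TensorProduct.assoc R X Y D).toLinearMap ∘ₗ g.lTensor _)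
    (g := (g.lTensor Y).lTensor X ∘ₗ (TensorProduct.assoc R X Y C).toLinearMap) ?_ x
  ext; simp

theorem legs22_lTensor (f : X ⊗[R] Y →ₗ[R] X' ⊗[R] Y') (g : C →ₗ[R] D)
    (x : X ⊗[R] (Y ⊗[R] C)) :
    legs22 D f ((g.lTensor Y).lTensor X x) = (g.lTensor Y').lTensor X' (legs22 C f x) := by
  refine LinearMap.congr_fun (f := legs22 D f ∘ₗ (g.lTensor Y).lTensor X)
    (g := (g.lTensor Y').lTensor X' ∘ₗ legs22 C f) ?_ x
  ext x y c
  simp [← assoc_lTensor]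

theorem lTensor_legs22_lTensor (f : X ⊗[R] Y →ₗ[R] X' ⊗[R] Y') (g : C →ₗ[R] D)
    (x : Z ⊗[R] (X ⊗[R] (Y ⊗[R] C))) :
    (legs22 D f).lTensor Z (((g.lTensor Y).lTensor X).lTensor Z x)
      = ((g.lTensor Y').lTensor X').lTensor Z ((legs22 C f).lTensor Z x) := by
  simp only [← LinearMap.lTensor_comp_apply]
  congr 2
  exact LinearMap.ext fun x => legs22_lTensor f g x

theorem legs21_lTensor (f : X ⊗[R] Y →ₗ[R] Z) (g : C →ₗ[R] D) (x : X ⊗[R] (Y ⊗[R] C)) :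
    legs21 D f ((g.lTensor Y).lTensor X x) = g.lTensor Z (legs21 C f x) := by
  refine LinearMap.congr_fun (f := legs21 D f ∘ₗ (g.lTensor Y).lTensor X)
    (g := g.lTensor Z ∘ₗ legs21 C f) ?_ x
  ext; simp

theorem legs12_lTensor (f : Z →ₗ[R] X ⊗[R] Y) (g : C →ₗ[R] D) (x : Z ⊗[R] C) :
    legs12 D f (g.lTensor Z x) = (g.lTensor Y).lTensor X (legs12 C f x) := by
  refine LinearMap.congr_fun (f := legs12 D f ∘ₗ g.lTensor Z)
    (g := (g.lTensor Y).lTensor X ∘ₗ legs12 C f) ?_ x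
  ext x c
  simp [← assoc_lTensor]

/-- Reassociation of a right-nested triple with a further factor. -/
noncomputable def assoc₃ (X Y Z C : Type*) [AddCommMonoid X] [AddCommMonoid Y] [AddCommMonoid Z]
    [AddCommMonoid C] [Module R X] [Module R Y] [Module R Z] [Module R C] :
    (X ⊗[R] (Y ⊗[R] Z)) ⊗[R] C →ₗ[R] X ⊗[R] (Y ⊗[R] (Z ⊗[R] C)) :=
  (TensorProduct.assoc R Y Z C).toLinearMap.lTensor X
    ∘ₗ (TensorProduct.assoc R X (Y ⊗[R] Z) C).toLinearMap

@[simp] theorem assoc₃_tmul (x : X) (y : Y) (z : Z) (c : C) :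
    assoc₃ (R := R) X Y Z C ((x ⊗ₜ (y ⊗ₜ z)) ⊗ₜ c) = x ⊗ₜ (y ⊗ₜ (z ⊗ₜ c)) := rfl

theorem legs22_assoc (f : X ⊗[R] Y →ₗ[R] X' ⊗[R] Y') (t : X ⊗[R] Y) (c : C) :
    legs22 C f (TensorProduct.assoc R X Y C (t ⊗ₜ c))
      = TensorProduct.assoc R X' Y' C (f t ⊗ₜ c) := by
  simp [legs22]

theorem legs21_assoc (f : X ⊗[R] Y →ₗ[R] Z) (t : X ⊗[R] Y) (c : C) :
    legs21 C f (TensorProduct.assoc R X Y C (t ⊗ₜ c)) = f t ⊗ₜ c := by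
  simp [legs21]

theorem legs12_assoc (f : Z →ₗ[R] X ⊗[R] Y) (t : Z ⊗[R] D) (c : C) :
    legs12 (D ⊗[R] C) f (TensorProduct.assoc R Z D C (t ⊗ₜ c))
      = assoc₃ X Y D C (legs12 D f t ⊗ₜ c) := by
  induction t with
  | zero => simp
  | add a b ha hb => simp [TensorProduct.add_tmul, ha, hb]
  | tmul z d =>
    simp only [TensorProduct.assoc_tmul, legs12_tmul]
    induction f z with
    | zero => simp
    | add a b ha hb => simp [TensorProduct.add_tmul, ha, hb]
    | tmul x y => simp

theorem lTensor_legs12_assoc (f : Z →ₗ[R] X ⊗[R] Y) (t : D ⊗[R] Z) (c : C) :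
    (legs12 C f).lTensor D (TensorProduct.assoc R D Z C (t ⊗ₜ c))
      = assoc₃ D X Y C (f.lTensor D t ⊗ₜ c) := by
  induction t with
  | zero => simp
  | add a b ha hb => simp [TensorProduct.add_tmul, ha, hb]
  | tmul d z => simp [assoc₃]

theorem lTensor_legs22_assoc₃ (f : X ⊗[R] Y →ₗ[R] X' ⊗[R] Y') (t : D ⊗[R] (X ⊗[R] Y)) (c : C) :
    (legs22 C f).lTensor D (assoc₃ D X Y C (t ⊗ₜ c)) = assoc₃ D X' Y' C (f.lTensor D t ⊗ₜ c) := by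
  induction t with
  | zero => simp
  | add a b ha hb => simp [TensorProduct.add_tmul, ha, hb]
  | tmul d z => simp [assoc₃, legs22_assoc]

theorem lTensor_legs21_assoc₃ (f : X ⊗[R] Y →ₗ[R] Z) (t : D ⊗[R] (X ⊗[R] Y)) (c : C) :
    (legs21 C f).lTensor D (assoc₃ D X Y C (t ⊗ₜ c))
      = TensorProduct.assoc R D Z C (f.lTensor D t ⊗ₜ c) := by
  induction t with
  | zero => simp
  | add a b ha hb => simp [TensorProduct.add_tmul, ha, hb]
  | tmul d z => simp [assoc₃, legs21_assoc]

theorem assoc₃_assoc (t : X ⊗[R] Y) (d : D) (c : C) :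
    assoc₃ (R := R) X Y D C (TensorProduct.assoc R X Y D (t ⊗ₜ d) ⊗ₜ c)
      = TensorProduct.assoc R X Y (D ⊗[R] C) (t ⊗ₜ (d ⊗ₜ c)) := by
  induction t with
  | zero => simp
  | add a b ha hb => simp [TensorProduct.add_tmul, ha, hb]
  | tmul x y => simp

theorem assoc₃_surjective : Function.Surjective (assoc₃ (R := R) X Y D C) :=
  ((TensorProduct.congr (LinearEquiv.refl R X) (TensorProduct.assoc R Y D C)).surjective).comp
    (TensorProduct.assoc R X (Y ⊗[R] D) C).surjective

theorem legs22_assoc₃ (f : X ⊗[R] Y →ₗ[R] X' ⊗[R] Y') (t : X ⊗[R] (Y ⊗[R] D)) (c : C) :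
    legs22 (D ⊗[R] C) f (assoc₃ X Y D C (t ⊗ₜ c)) = assoc₃ X' Y' D C (legs22 D f t ⊗ₜ c) := by
  obtain ⟨t, rfl⟩ := (TensorProduct.assoc R X Y D).surjective t
  induction t with
  | zero => simp
  | add a b ha hb => simp [TensorProduct.add_tmul, ha, hb]
  | tmul t d =>
    rw [legs22_assoc, assoc₃_assoc, assoc₃_assoc, legs22_assoc]

theorem legs21_assoc₃ (f : X ⊗[R] Y →ₗ[R] Z) (t : X ⊗[R] (Y ⊗[R] D)) (c : C) :
    legs21 (D ⊗[R] C) f (assoc₃ X Y D C (t ⊗ₜ c))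
      = TensorProduct.assoc R Z D C (legs21 D f t ⊗ₜ c) := by
  refine LinearMap.congr_fun
    (f := legs21 (D ⊗[R] C) f ∘ₗ assoc₃ X Y D C ∘ₗ (TensorProduct.mk R _ C).flip c)
    (g := (TensorProduct.assoc R Z D C).toLinearMap
      ∘ₗ (TensorProduct.mk R _ C).flip c ∘ₗ legs21 D f) ?_ t
  ext x y d
  simp

theorem assoc_comp_legs22 {W : Type*} [AddCommMonoid W] [Module R W]
    (t : X ⊗[R] Y →ₗ[R] Y' ⊗[R] X') (s : X' ⊗[R] Z →ₗ[R] Z' ⊗[R] W)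
    (x : X ⊗[R] ((Y ⊗[R] Z) ⊗[R] C)) :
    TensorProduct.assoc R Y' Z' (W ⊗[R] C) (legs22 C
        ((TensorProduct.assoc R Y' Z' W).symm.toLinearMap ∘ₗ s.lTensor Y' ∘ₗ legs22 Z t) x)
      = (legs22 C s).lTensor Y' (legs22 (Z ⊗[R] C) t
          ((TensorProduct.assoc R Y Z C).toLinearMap.lTensor X x)) := by
  refine LinearMap.congr_fun
    (f := (TensorProduct.assoc R Y' Z' (W ⊗[R] C)).toLinearMap ∘ₗ legs22 C
        ((TensorProduct.assoc R Y' Z' W).symm.toLinearMap ∘ₗ s.lTensor Y' ∘ₗ legs22 Z t))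
    (g := (legs22 C s).lTensor Y' ∘ₗ legs22 (Z ⊗[R] C) t ∘ₗ
          (TensorProduct.assoc R Y Z C).toLinearMap.lTensor X) ?_ x
  ext x y z c
  simp only [TensorProduct.AlgebraTensorModule.curry_apply, TensorProduct.curry_apply,
    LinearMap.coe_restrictScalars, LinearMap.comp_apply, legs22_tmul, LinearEquiv.coe_coe,
    LinearMap.lTensor_tmul, TensorProduct.assoc_tmul]
  induction t (x ⊗ₜ y) with
  | zero => simp
  | add a b ha hb => simp_all [TensorProduct.add_tmul]
  | tmul y x =>
    simp only [TensorProduct.assoc_tmul, LinearMap.lTensor_tmul, legs22_tmul]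
    induction s (x ⊗ₜ z) with
    | zero => simp
    | add a b ha hb => simp_all [TensorProduct.add_tmul, TensorProduct.tmul_add]
    | tmul z w => simp

theorem legs22_lTensor_rTensor {B B' : Type*} [AddCommMonoid B] [AddCommMonoid B'] [Module R B]
    [Module R B'] {S : X ⊗[R] B →ₗ[R] B ⊗[R] Y} {S' : X ⊗[R] B' →ₗ[R] B' ⊗[R] Y}
    {e : B →ₗ[R] B'} (h : S' ∘ₗ e.lTensor X = e.rTensor Y ∘ₗ S) (x : X ⊗[R] (B ⊗[R] C)) :
    legs22 C S' ((e.rTensor C).lTensor X x) = e.rTensor (Y ⊗[R] C) (legs22 C S x) := by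
  obtain ⟨x, rfl⟩ := (TensorProduct.assoc R X B C).surjective x
  induction x with
  | zero => simp
  | add a b ha hb => simp only [map_add, ha, hb]
  | tmul t c =>
    have e1 : (e.rTensor C).lTensor X (TensorProduct.assoc R X B C (t ⊗ₜ c))
        = TensorProduct.assoc R X B' C (e.lTensor X t ⊗ₜ c) := by
      induction t with
      | zero => simp
      | add a b ha hb => simp only [TensorProduct.add_tmul, map_add, ha, hb]
      | tmul x b => simp
    have e2 := LinearMap.congr_fun h t
    simp only [LinearMap.comp_apply] at e2
    rw [e1, legs22_assoc, legs22_assoc, e2]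
    induction S t with
    | zero => simp
    | add a b ha hb => simp_all [TensorProduct.add_tmul]
    | tmul x b => simp

theorem legs21_lTensor_rTensor {B B' : Type*} [AddCommMonoid B] [AddCommMonoid B'] [Module R B]
    [Module R B'] {P : X ⊗[R] B →ₗ[R] B} {P' : X ⊗[R] B' →ₗ[R] B'}
    {e : B →ₗ[R] B'} (h : P' ∘ₗ e.lTensor X = e ∘ₗ P) (x : X ⊗[R] (B ⊗[R] C)) :
    legs21 C P' ((e.rTensor C).lTensor X x) = e.rTensor C (legs21 C P x) := by
  refine LinearMap.congr_fun (f := legs21 C P' ∘ₗ (e.rTensor C).lTensor X)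
    (g := e.rTensor C ∘ₗ legs21 C P) ?_ x
  ext x b c
  have e := LinearMap.congr_fun h (x ⊗ₜ b)
  simp only [LinearMap.comp_apply, LinearMap.lTensor_tmul] at e
  simp [e]

theorem legs21_comp_legs21 {W : Type*} [AddCommMonoid W] [Module R W]
    (f : X ⊗[R] Z →ₗ[R] Z') (g : Y ⊗[R] W →ₗ[R] Z)
    (x : (X ⊗[R] Y) ⊗[R] (W ⊗[R] C)) :
    legs21 C (f ∘ₗ g.lTensor X ∘ₗ (TensorProduct.assoc R X Y W).toLinearMap) x
      = legs21 C f ((legs21 C g).lTensor X (TensorProduct.assoc R X Y (W ⊗[R] C) x)) := by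
  refine LinearMap.congr_fun (f := legs21 C
      (f ∘ₗ g.lTensor X ∘ₗ (TensorProduct.assoc R X Y W).toLinearMap))
    (g := legs21 C f ∘ₗ (legs21 C g).lTensor X
      ∘ₗ (TensorProduct.assoc R X Y (W ⊗[R] C)).toLinearMap) ?_ x
  ext; simp

end Legs

section Tails

variable {H B : Type u} [AddCommGroup H] [Module k H] [AddCommGroup B] [Module k B]
  {δ : H →ₗ[k] H ⊗[k] H} {c : H ⊗[k] H →ₗ[k] H ⊗[k] H}
  {S : H ⊗[k] B →ₗ[k] B ⊗[k] H} {P : H ⊗[k] B →ₗ[k] B}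
  (C : Type u) [AddCommGroup C] [Module k C]

theorem legs12_coassoc (h : legs12 H δ ∘ₗ δ = δ.lTensor H ∘ₗ δ) :
    legs12 (H ⊗[k] C) δ ∘ₗ legs12 C δ = (legs12 C δ).lTensor H ∘ₗ legs12 C δ := by
  refine TensorProduct.ext' fun t c => ?_
  have e := LinearMap.congr_fun h t
  simp only [LinearMap.comp_apply] at e
  simp only [LinearMap.comp_apply, legs12_tmul, legs12_assoc, lTensor_legs12_assoc, e]

theorem legs12_braid (h : legs12 H δ ∘ₗ c = c.lTensor H ∘ₗ legs22 H c ∘ₗ δ.lTensor H) :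
    legs12 (H ⊗[k] C) δ ∘ₗ legs22 C c
      = (legs22 C c).lTensor H ∘ₗ legs22 (H ⊗[k] C) c ∘ₗ (legs12 C δ).lTensor H := by
  rw [← LinearMap.cancel_right (TensorProduct.assoc k H H C).surjective]
  refine TensorProduct.ext' fun t c => ?_
  have e := LinearMap.congr_fun h t
  simp only [LinearMap.comp_apply] at e
  simp only [LinearMap.comp_apply, LinearEquiv.coe_coe, legs22_assoc, lTensor_legs12_assoc,
    legs12_assoc, lTensor_legs22_assoc₃, legs22_assoc₃, e]

/-- `(ρ⊗id)∘(id⊗s)∘(Δ⊗id)` for arbitrary linear maps. -/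
noncomputable def twistOf (δ : H →ₗ[k] H ⊗[k] H) (S : H ⊗[k] B →ₗ[k] B ⊗[k] H)
    (P : H ⊗[k] B →ₗ[k] B) : H ⊗[k] B →ₗ[k] B ⊗[k] H :=
  legs21 H P ∘ₗ S.lTensor H ∘ₗ legs12 B δ

theorem legs22_twistOf :
    legs22 C (twistOf δ S P)
      = legs21 (H ⊗[k] C) P ∘ₗ (legs22 C S).lTensor H ∘ₗ legs12 (B ⊗[k] C) δ := by
  rw [← LinearMap.cancel_right (TensorProduct.assoc k H B C).surjective]
  refine TensorProduct.ext' fun t c => ?_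
  simp only [LinearMap.comp_apply, LinearEquiv.coe_coe, legs22_assoc, twistOf,
    legs12_assoc, lTensor_legs22_assoc₃, legs21_assoc₃]

theorem legs22_comul (h : δ.lTensor B ∘ₗ S = legs22 H S ∘ₗ S.lTensor H ∘ₗ legs12 B δ) :
    (legs12 C δ).lTensor B ∘ₗ legs22 C S
      = legs22 (H ⊗[k] C) S ∘ₗ (legs22 C S).lTensor H ∘ₗ legs12 (B ⊗[k] C) δ := by
  rw [← LinearMap.cancel_right (TensorProduct.assoc k H B C).surjective]
  refine TensorProduct.ext' fun t c => ?_
  have e := LinearMap.congr_fun h t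
  simp only [LinearMap.comp_apply] at e
  simp only [LinearMap.comp_apply, LinearEquiv.coe_coe, legs22_assoc, lTensor_legs12_assoc,
    legs12_assoc, lTensor_legs22_assoc₃, legs22_assoc₃, e]

theorem legs22_yang_baxter (h : legs22 H S ∘ₗ S.lTensor H ∘ₗ legs22 B c
      = c.lTensor B ∘ₗ legs22 H S ∘ₗ S.lTensor H) :
    legs22 (H ⊗[k] C) S ∘ₗ (legs22 C S).lTensor H ∘ₗ legs22 (B ⊗[k] C) c
      = (legs22 C c).lTensor B ∘ₗ legs22 (H ⊗[k] C) S ∘ₗ (legs22 C S).lTensor H := by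
  rw [← LinearMap.cancel_right (assoc₃_surjective (R := k) (X := H) (Y := H) (D := B) (C := C))]
  refine TensorProduct.ext' fun t c => ?_
  have e := LinearMap.congr_fun h t
  simp only [LinearMap.comp_apply] at e
  simp only [LinearMap.comp_apply, lTensor_legs22_assoc₃, legs22_assoc₃, e]

theorem legs22_act {D P₁ : Type u} [AddCommGroup D] [Module k D] [AddCommGroup P₁] [Module k P₁]
    {c : H ⊗[k] P₁ →ₗ[k] P₁ ⊗[k] H} {P : P₁ ⊗[k] B →ₗ[k] B}
    (h : S ∘ₗ P.lTensor H = legs21 H P ∘ₗ S.lTensor P₁ ∘ₗ legs22 B c) :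
    legs22 D S ∘ₗ (legs21 D P).lTensor H
      = legs21 (H ⊗[k] D) P ∘ₗ (legs22 D S).lTensor P₁ ∘ₗ legs22 (B ⊗[k] D) c := by
  rw [← LinearMap.cancel_right (assoc₃_surjective (R := k) (X := H) (Y := P₁) (D := B) (C := D))]
  refine TensorProduct.ext' fun t c => ?_
  have e := LinearMap.congr_fun h t
  simp only [LinearMap.comp_apply] at e
  simp only [LinearMap.comp_apply, lTensor_legs22_assoc₃, legs22_assoc₃, legs22_assoc,
    legs21_assoc₃, lTensor_legs21_assoc₃, e]

end Tails

section Product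

variable {H A B : Type u} [AddCommGroup H] [Module k H]
  [AddCommGroup A] [Module k A] [AddCommGroup B] [Module k B]

/-- The twist of `H` past `B⊗A`. -/
noncomputable def prodTwist (S : H ⊗[k] B →ₗ[k] B ⊗[k] H) (s : H ⊗[k] A →ₗ[k] A ⊗[k] H) :
    H ⊗[k] (B ⊗[k] A) →ₗ[k] (B ⊗[k] A) ⊗[k] H :=
  (TensorProduct.assoc k B A H).symm.toLinearMap ∘ₗ s.lTensor B ∘ₗ legs22 A S

/-- The diagonal action of `H` on `B⊗A`. -/
noncomputable def prodAct (δ : H →ₗ[k] H ⊗[k] H) (S : H ⊗[k] B →ₗ[k] B ⊗[k] H)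
    (P : H ⊗[k] B →ₗ[k] B) (ρ : H ⊗[k] A →ₗ[k] A) : H ⊗[k] (B ⊗[k] A) →ₗ[k] B ⊗[k] A :=
  ρ.lTensor B ∘ₗ legs21 (H ⊗[k] A) P ∘ₗ (legs22 A S).lTensor H ∘ₗ legs12 (B ⊗[k] A) δ

variable {δ : H →ₗ[k] H ⊗[k] H} {c : H ⊗[k] H →ₗ[k] H ⊗[k] H}
  {S : H ⊗[k] B →ₗ[k] B ⊗[k] H} {P : H ⊗[k] B →ₗ[k] B}
  {s : H ⊗[k] A →ₗ[k] A ⊗[k] H} {ρ : H ⊗[k] A →ₗ[k] A}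

theorem assoc_prodTwist (x : H ⊗[k] (B ⊗[k] A)) :
    TensorProduct.assoc k B A H (prodTwist S s x) = s.lTensor B (legs22 A S x) := by
  simp [prodTwist]

theorem lTensor_assoc_prodTwist {X : Type u} [AddCommGroup X] [Module k X]
    (x : X ⊗[k] (H ⊗[k] (B ⊗[k] A))) :
    (TensorProduct.assoc k B A H).toLinearMap.lTensor X ((prodTwist S s).lTensor X x)
      = (s.lTensor B).lTensor X ((legs22 A S).lTensor X x) := by
  simp only [← LinearMap.lTensor_comp_apply]
  congr 2
  refine LinearMap.ext fun x => ?_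
  simp [prodTwist]

theorem assoc_legs22_prodTwist {C : Type u} [AddCommGroup C] [Module k C]
    (x : H ⊗[k] ((B ⊗[k] A) ⊗[k] C)) :
    TensorProduct.assoc k B A (H ⊗[k] C) (legs22 C (prodTwist S s) x)
      = (legs22 C s).lTensor B (legs22 (A ⊗[k] C) S
          ((TensorProduct.assoc k B A C).toLinearMap.lTensor H x)) :=
  assoc_comp_legs22 (R := k) (X := H) (Y := B) (Z := A) (X' := H) (Y' := B) (Z' := A) (W := H)
    (C := C) S s x

theorem assoc_legs21_prodAct {C : Type u} [AddCommGroup C] [Module k C]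
    (x : H ⊗[k] ((B ⊗[k] A) ⊗[k] C)) :
    TensorProduct.assoc k B A C (legs21 C (prodAct δ S P ρ) x)
      = (legs21 C ρ).lTensor B (legs21 (H ⊗[k] (A ⊗[k] C)) P ((legs22 (A ⊗[k] C) S).lTensor H
          (legs12 (B ⊗[k] (A ⊗[k] C)) δ
            ((TensorProduct.assoc k B A C).toLinearMap.lTensor H x)))) := by
  refine LinearMap.congr_fun
    (f := (TensorProduct.assoc k B A C).toLinearMap ∘ₗ legs21 C (prodAct δ S P ρ))
    (g := (legs21 C ρ).lTensor B ∘ₗ legs21 (H ⊗[k] (A ⊗[k] C)) P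
      ∘ₗ (legs22 (A ⊗[k] C) S).lTensor H ∘ₗ legs12 (B ⊗[k] (A ⊗[k] C)) δ
      ∘ₗ (TensorProduct.assoc k B A C).toLinearMap.lTensor H) ?_ x
  ext h b a c
  simp only [TensorProduct.AlgebraTensorModule.curry_apply, TensorProduct.curry_apply,
    LinearMap.coe_restrictScalars, LinearMap.comp_apply, legs21_tmul, LinearEquiv.coe_coe,
    LinearMap.lTensor_tmul, TensorProduct.assoc_tmul, prodAct, legs12_tmul]
  induction δ h with
  | zero => simp
  | add a b ha hb => simp_all [TensorProduct.add_tmul]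
  | tmul h₁ h₂ =>
    simp only [TensorProduct.assoc_tmul, LinearMap.lTensor_tmul, legs22_tmul]
    induction S (h₂ ⊗ₜ b) with
    | zero => simp
    | add a b ha hb => simp_all [TensorProduct.add_tmul, TensorProduct.tmul_add]
    | tmul z w => simp

end Product

/-- A space `B` with maps `S : H⊗B → B⊗H` and `P : H⊗B → B` satisfying the compatibilities
with the comultiplication of `H` and the map `c` that do not refer to a product on `B`. -/
structure IsTwistedAction {H B : Type u} [AddCommGroup H] [Module k H]
    [AddCommGroup B] [Module k B] (δ : H →ₗ[k] H ⊗[k] H)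
    (c : H ⊗[k] H →ₗ[k] H ⊗[k] H) (S : H ⊗[k] B →ₗ[k] B ⊗[k] H)
    (P : H ⊗[k] B →ₗ[k] B) : Prop where
  comul : δ.lTensor B ∘ₗ S = legs22 H S ∘ₗ S.lTensor H ∘ₗ legs12 B δ
  braid : legs22 H S ∘ₗ S.lTensor H ∘ₗ legs22 B c
    = c.lTensor B ∘ₗ legs22 H S ∘ₗ S.lTensor H
  act : S ∘ₗ P.lTensor H = legs21 H P ∘ₗ S.lTensor H ∘ₗ legs22 B c

section ProductAction

variable {H A B : Type u} [AddCommGroup H] [Module k H]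
  [AddCommGroup A] [Module k A] [AddCommGroup B] [Module k B]
  {δ : H →ₗ[k] H ⊗[k] H} {c : H ⊗[k] H →ₗ[k] H ⊗[k] H}
  {S : H ⊗[k] B →ₗ[k] B ⊗[k] H} {P : H ⊗[k] B →ₗ[k] B}
  {s : H ⊗[k] A →ₗ[k] A ⊗[k] H} {ρ : H ⊗[k] A →ₗ[k] A}

theorem IsTwistedAction.prod (hB : IsTwistedAction δ c S P) (hA : IsTwistedAction δ c s ρ)
    (hc : legs12 H δ ∘ₗ c = c.lTensor H ∘ₗ legs22 H c ∘ₗ δ.lTensor H) :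
    IsTwistedAction δ c (prodTwist S s) (prodAct δ S P ρ) where
  comul := by
    refine LinearMap.ext fun x => (TensorProduct.assoc k B A (H ⊗[k] H)).injective ?_
    have e₁ := LinearMap.congr_fun (congrArg (LinearMap.lTensor B) hA.comul)
    have e₂ := LinearMap.congr_fun (legs22_comul A hB.comul)
    simp only [LinearMap.lTensor_comp, LinearMap.comp_apply] at e₁ e₂
    simp only [LinearMap.comp_apply]
    rw [assoc_lTensor, assoc_prodTwist, e₁, e₂, assoc_legs22_prodTwist,
      lTensor_assoc_prodTwist, legs22_lTensor]
  braid := by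
    refine LinearMap.ext fun x => (TensorProduct.assoc k B A (H ⊗[k] H)).injective ?_
    have e₁ := LinearMap.congr_fun (congrArg (LinearMap.lTensor B) hA.braid)
    have e₂ := LinearMap.congr_fun (legs22_yang_baxter A hB.braid)
    simp only [LinearMap.lTensor_comp, LinearMap.comp_apply] at e₁ e₂
    simp only [LinearMap.comp_apply]
    rw [assoc_lTensor, assoc_legs22_prodTwist, assoc_legs22_prodTwist,
      lTensor_assoc_prodTwist, lTensor_assoc_prodTwist, legs22_lTensor, legs22_lTensor, e₂, e₁]
  act := by
    refine LinearMap.ext fun x => (TensorProduct.assoc k B A H).injective ?_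
    have e₁ := LinearMap.congr_fun (congrArg (LinearMap.lTensor B) hA.act)
    have e₂ := LinearMap.congr_fun (legs22_act (D := H ⊗[k] A) hB.act)
    have e₃ := LinearMap.congr_fun
      (congrArg (LinearMap.lTensor H) (legs22_yang_baxter A hB.braid))
    have e₄ := LinearMap.congr_fun (legs12_braid (B ⊗[k] A) hc)
    simp only [LinearMap.lTensor_comp, LinearMap.comp_apply] at e₁ e₂ e₃ e₄
    simp only [LinearMap.comp_apply]
    rw [assoc_prodTwist, assoc_legs21_prodAct, lTensor_assoc_prodTwist, legs12_lTensor,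
      legs12_lTensor, e₄]
    simp only [prodAct, LinearMap.lTensor_comp, LinearMap.comp_apply]
    rw [legs22_lTensor, e₁, e₂]
    simp only [legs21_lTensor, legs22_lTensor, lTensor_legs22_lTensor]
    rw [e₃, legs21_lTensor]

theorem twistOf_prod (hB : IsTwistedAction δ c S P)
    (hδ : legs12 H δ ∘ₗ δ = δ.lTensor H ∘ₗ δ) :
    twistOf δ (prodTwist S s) (prodAct δ S P ρ) = prodTwist (twistOf δ S P) (twistOf δ s ρ) := by
  refine LinearMap.ext fun x => (TensorProduct.assoc k B A H).injective ?_
  have e₁ := LinearMap.congr_fun (legs22_twistOf (δ := δ) (S := S) (P := P) A)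
  have e₂ := LinearMap.congr_fun (congrArg (LinearMap.lTensor H) (legs22_comul A hB.comul))
  have e₃ := LinearMap.congr_fun (legs12_coassoc (B ⊗[k] A) hδ)
  simp only [LinearMap.lTensor_comp, LinearMap.comp_apply] at e₁ e₂ e₃
  rw [assoc_prodTwist, e₁]
  simp only [twistOf, LinearMap.lTensor_comp, LinearMap.comp_apply]
  rw [assoc_legs21_prodAct, lTensor_assoc_prodTwist, legs12_lTensor, legs12_lTensor, e₃,
    ← legs21_lTensor P (legs12 A δ), e₂]
  simp only [legs21_lTensor, lTensor_legs22_lTensor]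

theorem IsTwistedAction.congr {B' : Type u} [AddCommGroup B'] [Module k B']
    {S' : H ⊗[k] B' →ₗ[k] B' ⊗[k] H} {P' : H ⊗[k] B' →ₗ[k] B'} (e : B ≃ₗ[k] B')
    (hS : S' ∘ₗ e.toLinearMap.lTensor H = e.toLinearMap.rTensor H ∘ₗ S)
    (hP : P' ∘ₗ e.toLinearMap.lTensor H = e.toLinearMap ∘ₗ P)
    (h : IsTwistedAction δ c S P) : IsTwistedAction δ c S' P' := by
  have surj : Function.Surjective (e.toLinearMap.lTensor H) :=
    LinearMap.lTensor_surjective H e.surjective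
  have surj₂ : Function.Surjective ((e.toLinearMap.lTensor H).lTensor H) :=
    LinearMap.lTensor_surjective H surj
  have eS := LinearMap.congr_fun hS
  have eP := LinearMap.congr_fun hP
  have eS' := LinearMap.congr_fun (congrArg (LinearMap.lTensor H) hS)
  have eP' := LinearMap.congr_fun (congrArg (LinearMap.lTensor H) hP)
  obtain ⟨h₁, h₂, h₃⟩ := h
  have h₁ := LinearMap.congr_fun h₁
  have h₂ := LinearMap.congr_fun h₂
  have h₃ := LinearMap.congr_fun h₃
  simp only [LinearMap.lTensor_comp, LinearMap.comp_apply] at eS eP eS' eP' h₁ h₂ h₃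
  have exch (g : H →ₗ[k] H ⊗[k] H) (x : B ⊗[k] H) :
      g.lTensor B' (e.toLinearMap.rTensor H x) = e.toLinearMap.rTensor _ (g.lTensor B x) := by
    simp only [← LinearMap.comp_apply, LinearMap.lTensor_comp_rTensor,
      LinearMap.rTensor_comp_lTensor]
  have exch₂ (g : H ⊗[k] H →ₗ[k] H ⊗[k] H) (x : B ⊗[k] (H ⊗[k] H)) :
      g.lTensor B' (e.toLinearMap.rTensor _ x) = e.toLinearMap.rTensor _ (g.lTensor B x) := by
    simp only [← LinearMap.comp_apply, LinearMap.lTensor_comp_rTensor,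
      LinearMap.rTensor_comp_lTensor]
  refine ⟨?_, ?_, ?_⟩
  · rw [← LinearMap.cancel_right surj]
    refine LinearMap.ext fun x => ?_
    simp only [LinearMap.comp_apply]
    rw [eS, exch, h₁, legs12_lTensor, eS', legs22_lTensor_rTensor hS]
  · rw [← LinearMap.cancel_right surj₂]
    refine LinearMap.ext fun x => ?_
    simp only [LinearMap.comp_apply]
    rw [legs22_lTensor, eS', legs22_lTensor_rTensor hS, h₂, eS', legs22_lTensor_rTensor hS, exch₂]
  · rw [← LinearMap.cancel_right surj₂]
    refine LinearMap.ext fun x => ?_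
    simp only [LinearMap.comp_apply]
    rw [eP', eS, h₃, legs22_lTensor, eS', legs21_lTensor_rTensor hP]

theorem twistOf_congr {B' : Type u} [AddCommGroup B'] [Module k B']
    {S' : H ⊗[k] B' →ₗ[k] B' ⊗[k] H} {P' : H ⊗[k] B' →ₗ[k] B'} {e : B →ₗ[k] B'}
    (hS : S' ∘ₗ e.lTensor H = e.rTensor H ∘ₗ S) (hP : P' ∘ₗ e.lTensor H = e ∘ₗ P) :
    twistOf δ S' P' ∘ₗ e.lTensor H = e.rTensor H ∘ₗ twistOf δ S P := by
  have eS' := LinearMap.congr_fun (congrArg (LinearMap.lTensor H) hS)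
  refine LinearMap.ext fun x => ?_
  simp only [LinearMap.lTensor_comp, LinearMap.comp_apply] at eS'
  simp only [twistOf, LinearMap.comp_apply]
  rw [legs12_lTensor, eS', legs21_lTensor_rTensor hP]

end ProductAction

section Braided

variable {H P B : Type u} [AddCommGroup H] [Module k H] [AddCommGroup P] [Module k P]
  [AddCommGroup B] [Module k B]
  {δ : H →ₗ[k] H ⊗[k] H} {S : H ⊗[k] B →ₗ[k] B ⊗[k] H} {ρ : H ⊗[k] B →ₗ[k] B}
  {c : H ⊗[k] H →ₗ[k] H ⊗[k] H} {cP : H ⊗[k] P →ₗ[k] P ⊗[k] H}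
  {δP : P →ₗ[k] P ⊗[k] P} {SP : P ⊗[k] B →ₗ[k] B ⊗[k] P} {ρP : P ⊗[k] B →ₗ[k] B}

/-- The action of `H⊗P` on `B` obtained by acting first with `P`, then with `H`. -/
noncomputable def compAct (ρ : H ⊗[k] B →ₗ[k] B) (ρP : P ⊗[k] B →ₗ[k] B) :
    (H ⊗[k] P) ⊗[k] B →ₗ[k] B :=
  ρ ∘ₗ ρP.lTensor H ∘ₗ (TensorProduct.assoc k H P B).toLinearMap

/-- The twist of `H⊗P` past `B`. -/
noncomputable def compTwist (S : H ⊗[k] B →ₗ[k] B ⊗[k] H) (SP : P ⊗[k] B →ₗ[k] B ⊗[k] P) :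
    (H ⊗[k] P) ⊗[k] B →ₗ[k] B ⊗[k] (H ⊗[k] P) :=
  legs22 P S ∘ₗ SP.lTensor H ∘ₗ (TensorProduct.assoc k H P B).toLinearMap

/-- The comultiplication of the braided tensor product of `H` and `P`. -/
noncomputable def prodComul (δ : H →ₗ[k] H ⊗[k] H) (cP : H ⊗[k] P →ₗ[k] P ⊗[k] H)
    (δP : P →ₗ[k] P ⊗[k] P) : H ⊗[k] P →ₗ[k] (H ⊗[k] P) ⊗[k] (H ⊗[k] P) :=
  (TensorProduct.assoc k H P (H ⊗[k] P)).symm.toLinearMap ∘ₗ (legs22 P cP).lTensor H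
    ∘ₗ (TensorProduct.assoc k H H (P ⊗[k] P)).toLinearMap ∘ₗ TensorProduct.map δ δP

theorem legs21_compAct {C : Type u} [AddCommGroup C] [Module k C]
    (x : (H ⊗[k] P) ⊗[k] (B ⊗[k] C)) :
    legs21 C (compAct ρ ρP) x
      = legs21 C ρ ((legs21 C ρP).lTensor H (TensorProduct.assoc k H P (B ⊗[k] C) x)) :=
  legs21_comp_legs21 (R := k) (X := H) (Y := P) (Z := B) (Z' := B) (W := B) (C := C) ρ ρP x

theorem act_compAct (h : S ∘ₗ ρ.lTensor H = legs21 H ρ ∘ₗ S.lTensor H ∘ₗ legs22 B c)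
    (hP : S ∘ₗ ρP.lTensor H = legs21 H ρP ∘ₗ S.lTensor P ∘ₗ legs22 B cP) :
    S ∘ₗ (compAct ρ ρP).lTensor H
      = legs21 H (compAct ρ ρP) ∘ₗ S.lTensor (H ⊗[k] P) ∘ₗ legs22 B (prodTwist c cP) := by
  refine LinearMap.ext fun x => ?_
  have e₁ := LinearMap.congr_fun h
  have e₂ := LinearMap.congr_fun (congrArg (LinearMap.lTensor H) hP)
  simp only [LinearMap.lTensor_comp, LinearMap.comp_apply] at e₁ e₂
  simp only [LinearMap.comp_apply]
  rw [legs21_compAct, assoc_lTensor, assoc_legs22_prodTwist]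
  simp only [compAct, LinearMap.lTensor_comp, LinearMap.comp_apply]
  rw [e₁, legs22_lTensor, e₂]

theorem assoc_legs12_prodComul (x : (H ⊗[k] P) ⊗[k] B) :
    ((TensorProduct.assoc k H P B).toLinearMap.lTensor P).lTensor H
      (TensorProduct.assoc k H P ((H ⊗[k] P) ⊗[k] B) (legs12 B (prodComul δ cP δP) x))
      = (legs22 (P ⊗[k] B) cP).lTensor H (legs12 (P ⊗[k] (P ⊗[k] B)) δ
          ((legs12 B δP).lTensor H (TensorProduct.assoc k H P B x))) := by
  refine LinearMap.congr_fun
    (f := ((TensorProduct.assoc k H P B).toLinearMap.lTensor P).lTensor H ∘ₗ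
      (TensorProduct.assoc k H P ((H ⊗[k] P) ⊗[k] B)).toLinearMap ∘ₗ
      legs12 B (prodComul δ cP δP))
    (g := (legs22 (P ⊗[k] B) cP).lTensor H ∘ₗ legs12 (P ⊗[k] (P ⊗[k] B)) δ ∘ₗ
          (legs12 B δP).lTensor H ∘ₗ (TensorProduct.assoc k H P B).toLinearMap) ?_ x
  ext h p b
  simp only [TensorProduct.AlgebraTensorModule.curry_apply, TensorProduct.curry_apply,
    LinearMap.coe_restrictScalars, LinearMap.comp_apply, LinearEquiv.coe_coe,
    LinearMap.lTensor_tmul, TensorProduct.assoc_tmul, prodComul, legs12_tmul,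
    TensorProduct.map_tmul]
  induction δ h with
  | zero => simp
  | add a b ha hb => simp_all [TensorProduct.add_tmul]
  | tmul h₁ h₂ =>
    induction δP p with
    | zero => simp
    | add a b ha hb => simp_all [TensorProduct.add_tmul, TensorProduct.tmul_add]
    | tmul p₁ p₂ =>
      simp only [TensorProduct.assoc_tmul, LinearMap.lTensor_tmul, legs22_tmul]
      induction cP (h₂ ⊗ₜ p₁) with
      | zero => simp
      | add a b ha hb => simp_all [TensorProduct.add_tmul, TensorProduct.tmul_add]
      | tmul z w => simp

theorem compTwist_twistOf
    (hP : S ∘ₗ ρP.lTensor H = legs21 H ρP ∘ₗ S.lTensor P ∘ₗ legs22 B cP) :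
    compTwist (twistOf δ S ρ) (legs21 P ρP ∘ₗ SP.lTensor P ∘ₗ legs12 B δP)
      = legs21 (H ⊗[k] P) (compAct ρ ρP) ∘ₗ (compTwist S SP).lTensor (H ⊗[k] P)
        ∘ₗ legs12 B (prodComul δ cP δP) := by
  refine LinearMap.ext fun x => ?_
  have e₁ := LinearMap.congr_fun (legs22_twistOf (δ := δ) (S := S) (P := ρ) P)
  have e₂ := LinearMap.congr_fun (congrArg (LinearMap.lTensor H) (legs22_act (D := P) hP))
  simp only [LinearMap.lTensor_comp, LinearMap.comp_apply] at e₁ e₂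
  simp only [LinearMap.comp_apply]
  rw [legs21_compAct, assoc_lTensor]
  simp only [compTwist, LinearMap.lTensor_comp, LinearMap.comp_apply]
  rw [assoc_legs12_prodComul, e₁]
  simp only [LinearEquiv.coe_coe]
  rw [legs12_lTensor, legs12_lTensor, e₂]
  simp only [lTensor_legs22_lTensor]

end Braided

section Shuffle

variable {H P Q X : Type u} [AddCommGroup H] [Module k H] [AddCommGroup P] [Module k P]
  [AddCommGroup Q] [Module k Q] [AddCommGroup X] [Module k X]

/-- The extension of a shuffle `Q → P⊗P` by one factor on the left, using the passage `cP`
of `H` past `P`. -/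
noncomputable def shuffleStep (cP : H ⊗[k] P →ₗ[k] P ⊗[k] H) (τ : Q →ₗ[k] P ⊗[k] P) :
    (H ⊗[k] H) ⊗[k] Q →ₗ[k] (H ⊗[k] P) ⊗[k] (H ⊗[k] P) :=
  (TensorProduct.assoc k H P (H ⊗[k] P)).symm.toLinearMap
    ∘ₗ (legs22 P cP).lTensor H
    ∘ₗ (TensorProduct.assoc k H H (P ⊗[k] P)).toLinearMap
    ∘ₗ τ.lTensor (H ⊗[k] H)

variable (c : H ⊗[k] H →ₗ[k] H ⊗[k] H) (cP : H ⊗[k] P →ₗ[k] P ⊗[k] H)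
  (τ : Q →ₗ[k] P ⊗[k] P) (σ : P ⊗[k] H →ₗ[k] H ⊗[k] P)

theorem shuffleStep_snoc_tmul (a : H) (v : H ⊗[k] (Q ⊗[k] H)) :
    (σ.lTensor H ∘ₗ (TensorProduct.assoc k H P H).toLinearMap).lTensor (H ⊗[k] P)
      (TensorProduct.assoc k (H ⊗[k] P) (H ⊗[k] P) H ((shuffleStep cP τ).rTensor H
        ((TensorProduct.assoc k (H ⊗[k] H) Q H).symm
          (c.rTensor (Q ⊗[k] H) ((TensorProduct.assoc k H H (Q ⊗[k] H)).symm (a ⊗ₜ v))))))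
    = legs22 (H ⊗[k] P) (prodTwist c cP) (a ⊗ₜ
        (TensorProduct.assoc k H P (H ⊗[k] P)).symm
          ((σ.lTensor P).lTensor H ((TensorProduct.assoc k P P H).toLinearMap.lTensor H
            ((τ.rTensor H).lTensor H v)))) := by
  induction v with
  | zero => simp
  | add a b ha hb => simp only [TensorProduct.tmul_add, map_add, ha, hb]
  | tmul b w =>
    induction w with
    | zero => simp
    | add a b ha hb => simp only [TensorProduct.tmul_add, map_add, ha, hb]
    | tmul q d =>
      simp only [TensorProduct.assoc_symm_tmul, LinearMap.rTensor_tmul, LinearMap.lTensor_tmul,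
        LinearEquiv.coe_coe, shuffleStep, LinearMap.comp_apply]
      induction τ q with
      | zero => simp
      | add x y hx hy => simp only [TensorProduct.tmul_add, TensorProduct.add_tmul, map_add, hx, hy]
      | tmul p p' =>
        simp only [TensorProduct.assoc_tmul, LinearMap.lTensor_tmul,
          TensorProduct.assoc_symm_tmul, legs22_tmul, prodTwist, LinearMap.comp_apply]
        induction c (a ⊗ₜ b) with
        | zero => simp
        | add x y hx hy => simp only [TensorProduct.add_tmul, map_add, hx, hy]
        | tmul b' a' =>
          simp only [TensorProduct.assoc_tmul, LinearMap.lTensor_tmul, legs22_tmul]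
          induction cP (a' ⊗ₜ p) with
          | zero => simp
          | add x y hx hy =>
            simp only [TensorProduct.add_tmul, TensorProduct.tmul_add, map_add, hx, hy]
          | tmul p₁ a₁ => simp

theorem shuffleStep_succ {σ' : (H ⊗[k] P) ⊗[k] H →ₗ[k] H ⊗[k] (H ⊗[k] P)}
    (hσ : σ' = σ.lTensor H ∘ₗ (TensorProduct.assoc k H P H).toLinearMap)
    {τ' : (H ⊗[k] H) ⊗[k] Q →ₗ[k] (H ⊗[k] P) ⊗[k] (H ⊗[k] P)} (hτ : τ' = shuffleStep cP τ)
    (M : X →ₗ[k] H ⊗[k] (Q ⊗[k] H)) :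
    (TensorProduct.assoc k H (H ⊗[k] P) (H ⊗[k] (H ⊗[k] P))).symm.toLinearMap
      ∘ₗ (σ'.lTensor (H ⊗[k] P)).lTensor H
      ∘ₗ (TensorProduct.assoc k (H ⊗[k] P) (H ⊗[k] P) H).toLinearMap.lTensor H
      ∘ₗ (τ'.rTensor H).lTensor H
      ∘ₗ (TensorProduct.assoc k (H ⊗[k] H) Q H).symm.toLinearMap.lTensor H
      ∘ₗ (c.rTensor (Q ⊗[k] H)).lTensor H
      ∘ₗ (TensorProduct.assoc k H H (Q ⊗[k] H)).symm.toLinearMap.lTensor H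
      ∘ₗ (TensorProduct.assoc k H H (H ⊗[k] (Q ⊗[k] H))).toLinearMap
      ∘ₗ M.lTensor (H ⊗[k] H)
    = shuffleStep (prodTwist c cP)
      ((TensorProduct.assoc k H P (H ⊗[k] P)).symm.toLinearMap
        ∘ₗ (σ.lTensor P).lTensor H
        ∘ₗ (TensorProduct.assoc k P P H).toLinearMap.lTensor H
        ∘ₗ (τ.rTensor H).lTensor H ∘ₗ M) := by
  subst hσ hτ
  refine TensorProduct.ext' fun z q => ?_
  induction z with
  | zero => simp only [TensorProduct.zero_tmul, map_zero]
  | add a b ha hb => simp only [TensorProduct.add_tmul, map_add, ha, hb]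
  | tmul h a =>
    exact congrArg (TensorProduct.assoc k H (H ⊗[k] P) (H ⊗[k] (H ⊗[k] P))).symm
      (congrArg (h ⊗ₜ[k] ·) (shuffleStep_snoc_tmul c cP τ σ a (M q)))

theorem shuffleStep_id :
    (TensorProduct.assoc k H H (H ⊗[k] H)).symm.toLinearMap
      ∘ₗ ((LinearEquiv.refl k (H ⊗[k] H)).toLinearMap.lTensor H).lTensor H
      ∘ₗ (TensorProduct.assoc k H H H).toLinearMap.lTensor H
      ∘ₗ ((LinearMap.id (R := k) (M := H ⊗[k] H)).rTensor H).lTensor H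
      ∘ₗ (c.rTensor H).lTensor H
      ∘ₗ (TensorProduct.assoc k H H H).symm.toLinearMap.lTensor H
      ∘ₗ (TensorProduct.assoc k H H (H ⊗[k] H)).toLinearMap
    = shuffleStep c LinearMap.id := by
  simp only [shuffleStep, legs22, LinearMap.lTensor_comp, LinearEquiv.refl_toLinearMap,
    LinearMap.lTensor_id, LinearMap.rTensor_id, LinearMap.id_comp, LinearMap.comp_id,
    LinearMap.comp_assoc]

end Shuffle

section Powers

variable {H A : Type u} [AddCommGroup H] [Module k H] [AddCommGroup A] [Module k A]
  {δ : H →ₗ[k] H ⊗[k] H} {c : H ⊗[k] H →ₗ[k] H ⊗[k] H}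
  {s : H ⊗[k] A ≃ₗ[k] A ⊗[k] H} {ρ : H ⊗[k] A →ₗ[k] A}

theorem lTensor_symm_lTensor {B B' : Type u} [AddCommGroup B] [Module k B] [AddCommGroup B']
    [Module k B'] (e : B ≃ₗ[k] B') (x : H ⊗[k] B) :
    e.symm.toLinearMap.lTensor H (e.toLinearMap.lTensor H x) = x := by
  rw [← LinearMap.lTensor_comp_apply]
  simp

theorem tw1_succ_comp_snoc (t : H ⊗[k] A →ₗ[k] A ⊗[k] H) (l : ℕ) :
    tw1 t (l + 1) ∘ₗ (snoc k l).toLinearMap.lTensor H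
      = (snoc k l).toLinearMap.rTensor H ∘ₗ prodTwist (tw1 t l) t := by
  refine LinearMap.ext fun x => ?_
  simp only [tw1, LinearMap.comp_apply, lTensor_symm_lTensor]
  rfl

theorem twE1_succ_comp_snoc (l : ℕ) :
    (twE1 s (l + 1)).toLinearMap ∘ₗ (snoc k l).toLinearMap.lTensor H
      = (snoc k l).toLinearMap.rTensor H
        ∘ₗ prodTwist (twE1 s l).toLinearMap s.toLinearMap := by
  refine LinearMap.ext fun x => ?_
  have e : (TensorProduct.congr (LinearEquiv.refl k H) (snoc k l).symm)
      ((snoc k l).toLinearMap.lTensor H x) = x := lTensor_symm_lTensor (snoc k l) x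
  simp only [twE1, LinearMap.comp_apply, LinearEquiv.coe_coe, LinearEquiv.trans_apply, e]
  rfl

theorem rhoPow_succ_comp_snoc (l : ℕ) :
    rhoPow δ s ρ (l + 1) ∘ₗ (snoc k l).toLinearMap.lTensor H
      = (snoc k l).toLinearMap
        ∘ₗ prodAct δ (twE1 s l).toLinearMap (rhoPow δ s ρ l) ρ := by
  refine LinearMap.ext fun x => ?_
  simp only [rhoPow, LinearMap.comp_apply, lTensor_symm_lTensor, prodAct, legs22, legs21, legs12,
    LinearMap.lTensor_comp, ← LinearMap.lTensor_comp_rTensor]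

theorem isTwistedAction_pow (h : IsTwistedAction δ c s.toLinearMap ρ)
    (hc : legs12 H δ ∘ₗ c = c.lTensor H ∘ₗ legs22 H c ∘ₗ δ.lTensor H) :
    ∀ l : ℕ, IsTwistedAction δ c (twE1 s l).toLinearMap (rhoPow δ s ρ l)
  | 0 => h
  | l + 1 => ((isTwistedAction_pow h hc l).prod h hc).congr (snoc k l)
      (twE1_succ_comp_snoc l) (rhoPow_succ_comp_snoc l)

theorem tw1_twistOf (h : IsTwistedAction δ c s.toLinearMap ρ)
    (hc : legs12 H δ ∘ₗ c = c.lTensor H ∘ₗ legs22 H c ∘ₗ δ.lTensor H)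
    (hδ : legs12 H δ ∘ₗ δ = δ.lTensor H ∘ₗ δ) :
    ∀ l : ℕ, tw1 (twistOf δ s.toLinearMap ρ) l
      = twistOf δ (twE1 s l).toLinearMap (rhoPow δ s ρ l)
  | 0 => rfl
  | l + 1 => by
    have surj : Function.Surjective ((snoc k (M := A) l).toLinearMap.lTensor H) :=
      LinearMap.lTensor_surjective H (snoc k l).surjective
    rw [← LinearMap.cancel_right surj, tw1_succ_comp_snoc, tw1_twistOf h hc hδ l,
      twistOf_congr (twE1_succ_comp_snoc l) (rhoPow_succ_comp_snoc l),
      twistOf_prod (isTwistedAction_pow h hc l) hδ]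

/-- The passage of one factor `H` past `H^{⊗(n+1)}`, built from the left. -/
noncomputable def cross (c : H ⊗[k] H →ₗ[k] H ⊗[k] H) :
    ∀ n : ℕ, H ⊗[k] ↥(pw k H n) →ₗ[k] ↥(pw k H n) ⊗[k] H
  | 0 => c
  | n + 1 => prodTwist c (cross c n)

theorem cShuffle_succ : ∀ n : ℕ,
    cShuffle c (n + 1) = shuffleStep (cross c n) (cShuffle c n)
  | 0 => shuffleStep_id c
  | n + 1 => shuffleStep_succ c (cross c n) (cShuffle c n) (snoc k n).toLinearMap rfl
      (cShuffle_succ n) (mids c n)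

theorem comulP_succ (n : ℕ) :
    comulP c δ (n + 1) = prodComul δ (cross c n) (comulP c δ n) := by
  refine TensorProduct.ext' fun h p => ?_
  exact LinearMap.congr_fun (cShuffle_succ n) (δ h ⊗ₜ[k] dPow δ n p)

theorem act_rhoFull (h : IsTwistedAction δ c s.toLinearMap ρ)
    (hc : legs12 H δ ∘ₗ c = c.lTensor H ∘ₗ legs22 H c ∘ₗ δ.lTensor H) (r : ℕ) :
    ∀ n : ℕ, (twE1 s r).toLinearMap ∘ₗ (rhoFull δ s ρ n r).lTensor H
      = legs21 H (rhoFull δ s ρ n r) ∘ₗ (twE1 s r).toLinearMap.lTensor ↥(pw k H n)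
        ∘ₗ legs22 ↥(pw k A r) (cross c n)
  | 0 => (isTwistedAction_pow h hc r).act
  | n + 1 => act_compAct (isTwistedAction_pow h hc r).act (act_rhoFull h hc r n)

theorem twFull_twistOf (h : IsTwistedAction δ c s.toLinearMap ρ)
    (hc : legs12 H δ ∘ₗ c = c.lTensor H ∘ₗ legs22 H c ∘ₗ δ.lTensor H)
    (hδ : legs12 H δ ∘ₗ δ = δ.lTensor H ∘ₗ δ) (r : ℕ) :
    ∀ n : ℕ, twFull (twistOf δ s.toLinearMap ρ) n r
      = legs21 ↥(pw k H n) (rhoFull δ s ρ n r)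
        ∘ₗ (twEFull s n r).toLinearMap.lTensor ↥(pw k H n)
        ∘ₗ legs12 ↥(pw k A r) (comulP c δ n)
  | 0 => tw1_twistOf h hc hδ r
  | n + 1 => by
    have e : twFull (twistOf δ s.toLinearMap ρ) (n + 1) r
        = compTwist (tw1 (twistOf δ s.toLinearMap ρ) r)
            (twFull (twistOf δ s.toLinearMap ρ) n r) := rfl
    rw [e, tw1_twistOf h hc hδ r, twFull_twistOf h hc hδ r n, comulP_succ]
    exact compTwist_twistOf (act_rhoFull h hc r n)

end Powers

/-- `χ_{n,r} = (ρ_{n,r}⊗id_{H^{⊗n}})∘(id_{H^{⊗n}}⊗𝔰_{n,r})∘(Δ_{H^{⊗_c n}}⊗id_{A^{⊗r}})`. -/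
theorem chiFull_eq {H A : Type u} [Ring H] [Algebra k H] [Coalgebra k H]
    [Ring A] [Algebra k A]
    (bb : BraidedBialgebra k H) (tr : Transposition k bb.c A)
    (wa : WeakSAction k bb.c tr.s) :
    ∀ n r : ℕ,
      twFull (chi tr.s.toLinearMap wa.ρ) n r
        = LinearMap.rTensor ↥(pw k H n)
            (rhoFull (Coalgebra.comul (R := k) (A := H)) tr.s wa.ρ n r)
          ∘ₗ (TensorProduct.assoc k ↥(pw k H n) ↥(pw k A r) ↥(pw k H n)).symm.toLinearMap
          ∘ₗ LinearMap.lTensor ↥(pw k H n) (twEFull tr.s n r).toLinearMap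
          ∘ₗ (TensorProduct.assoc k ↥(pw k H n) ↥(pw k H n) ↥(pw k A r)).toLinearMap
          ∘ₗ LinearMap.rTensor ↥(pw k A r)
              (comulP bb.c.toLinearMap (Coalgebra.comul (R := k) (A := H)) n) := by
  intro n r
  have hA : IsTwistedAction (Coalgebra.comul (R := k) (A := H)) bb.c.toLinearMap
      tr.s.toLinearMap wa.ρ :=
    { comul := tr.s_comul
      braid := by
        rw [← LinearMap.cancel_right (TensorProduct.assoc k H H A).surjective]
        have e : legs22 A bb.c.toLinearMap ∘ₗ (TensorProduct.assoc k H H A).toLinearMap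
            = (TensorProduct.assoc k H H A).toLinearMap ∘ₗ bb.c.toLinearMap.rTensor A :=
          TensorProduct.ext' fun t a => legs22_assoc _ t a
        rw [LinearMap.comp_assoc, LinearMap.comp_assoc, e]
        exact tr.s_braid
      act := wa.rho_s }
  exact twFull_twistOf hA bb.braid_comul_left Coalgebra.coassoc r n
end

section
/- For all n, r ≥ 1, one has (id_{H^{⊗n}}⊗χ_{n,r})∘(Δ_{H^{⊗_c n}}⊗id_{A^{⊗r}})∘𝔰_{n,r}^{-1} = (id_{H^{⊗n}}⊗ρ_{n,r}⊗id_{H^{⊗n}})∘(Δ_{H^{⊗_c n}}⊗id_{A^{⊗r}}⊗id_{H^{⊗n}})∘(𝔰_{n,r}^{-1}⊗id_{H^{⊗n}})∘(id_{A^{⊗r}}⊗Δ_{H^{⊗_c n}}) as maps A^{⊗r}⊗H^{⊗n} → H^{⊗n}⊗A^{⊗r}⊗H^{⊗n} (here 𝔰_{n,r} is bijective since s is bijective). -/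
/-!
For all `n, r ≥ 1`,
`(id⊗χ_{n,r})∘(Δ_{H^{⊗_c n}}⊗id)∘𝔰_{n,r}⁻¹
  = (id⊗ρ_{n,r}⊗id)∘(Δ_{H^{⊗_c n}}⊗id⊗id)∘(𝔰_{n,r}⁻¹⊗id)∘(id⊗Δ_{H^{⊗_c n}})`
as maps `A^{⊗r}⊗H^{⊗n} → H^{⊗n}⊗A^{⊗r}⊗H^{⊗n}`.  (Here `pw k H n` denotes `H^{⊗(n+1)}`,
so the statement below, quantified over all `n r : ℕ`, covers exactly all `n, r ≥ 1`.)
-/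

open scoped TensorProduct

universe u

variable (k : Type u) [Field k]

variable {M : Type u} [AddCommGroup M] [Module k M]

variable {k}

section MonoidalLemmas

open CategoryTheory MonoidalCategory

universe v₁ u₁

local infixr:70 "⊠" => MonoidalCategoryStruct.tensorObj

variable {C : Type u₁} [Category.{v₁} C] [MonoidalCategory C]

/-- The extension of twists `X⊗A → A⊗X` and `X⊗B → B⊗X` to `X⊗(A⊗B) → (A⊗B)⊗X`. -/
def hTw {X A B : C} (t₁ : X ⊠ A ⟶ A ⊠ X) (t₂ : X ⊠ B ⟶ B ⊠ X) :
    X ⊠ (A ⊠ B) ⟶ (A ⊠ B) ⊠ X :=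
  (α_ X A B).inv ≫ t₁ ▷ B ≫ (α_ A X B).hom ≫ A ◁ t₂ ≫ (α_ A B X).inv

/-- The extension of twists `X⊗A → A⊗X` and `Y⊗A → A⊗Y` to `(X⊗Y)⊗A → A⊗(X⊗Y)`. -/
def vTw {X Y A : C} (u₁ : X ⊠ A ⟶ A ⊠ X) (u₂ : Y ⊠ A ⟶ A ⊠ Y) :
    (X ⊠ Y) ⊠ A ⟶ A ⊠ (X ⊠ Y) :=
  (α_ X Y A).hom ≫ X ◁ u₂ ≫ (α_ X A Y).inv ≫ u₁ ▷ Y ≫ (α_ A X Y).hom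

/-- The action on `A⊗B` induced by actions on `A` and `B`. -/
def hAct {X A B : C} (Δ : X ⟶ X ⊠ X) (s : X ⊠ A ⟶ A ⊠ X) (ρ₁ : X ⊠ A ⟶ A)
    (ρ₂ : X ⊠ B ⟶ B) : X ⊠ (A ⊠ B) ⟶ A ⊠ B :=
  Δ ▷ (A ⊠ B) ≫ (α_ X X (A ⊠ B)).hom ≫ X ◁ (α_ X A B).inv ≫ X ◁ s ▷ B ≫
    X ◁ (α_ A X B).hom ≫ (α_ X A (X ⊠ B)).inv ≫ (ρ₁ ▷ (X ⊠ B) ≫ A ◁ ρ₂)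

/-- The iterated action of `X⊗Y` on `A`. -/
def vAct {X Y A : C} (ρ₁ : X ⊠ A ⟶ A) (ρ₂ : Y ⊠ A ⟶ A) : (X ⊠ Y) ⊠ A ⟶ A :=
  (α_ X Y A).hom ≫ X ◁ ρ₂ ≫ ρ₁

/-- The braided tensor product of two comultiplications. -/
def braidComul {X Y : C} (c : X ⊠ Y ⟶ Y ⊠ X) (ΔX : X ⟶ X ⊠ X) (ΔY : Y ⟶ Y ⊠ Y) :
    X ⊠ Y ⟶ (X ⊠ Y) ⊠ (X ⊠ Y) :=
  (ΔX ▷ Y ≫ (X ⊠ X) ◁ ΔY) ≫ (α_ X X (Y ⊠ Y)).hom ≫ X ◁ (α_ X Y Y).inv ≫ X ◁ c ▷ Y ≫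
    X ◁ (α_ Y X Y).hom ≫ (α_ X Y (X ⊠ Y)).inv

/-- The twist `(ρ⊗id)∘(id⊗s)∘(Δ⊗id)`. -/
def chiTw {X A : C} (Δ : X ⟶ X ⊠ X) (s : X ⊠ A ⟶ A ⊠ X) (ρ : X ⊠ A ⟶ A) :
    X ⊠ A ⟶ A ⊠ X :=
  Δ ▷ A ≫ (α_ X X A).hom ≫ X ◁ s ≫ (α_ X A X).inv ≫ ρ ▷ X

/-- Transport of a twist along an isomorphism. -/
def conjTw {X A B : C} (e : A ≅ B) (t : X ⊠ A ⟶ A ⊠ X) : X ⊠ B ⟶ B ⊠ X :=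
  X ◁ e.inv ≫ t ≫ e.hom ▷ X

/-- Transport of an action along an isomorphism. -/
def conjAct {X A B : C} (e : A ≅ B) (ρ : X ⊠ A ⟶ A) : X ⊠ B ⟶ B :=
  X ◁ e.inv ≫ ρ ≫ e.hom

/-- Coassociativity. -/
def IsCoassoc {X : C} (Δ : X ⟶ X ⊠ X) : Prop :=
  Δ ≫ Δ ▷ X ≫ (α_ X X X).hom = Δ ≫ X ◁ Δ

/-- A twist is compatible with a comultiplication on the object moving right. -/
def ComulTw {X A : C} (Δ : X ⟶ X ⊠ X) (t : X ⊠ A ⟶ A ⊠ X) : Prop :=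
  t ≫ A ◁ Δ = Δ ▷ A ≫ (α_ X X A).hom ≫ X ◁ t ≫ (α_ X A X).inv ≫ t ▷ X ≫ (α_ A X X).hom

/-- A twist is compatible with a comultiplication on the object moving left. -/
def TwComul {X Y : C} (Δ : Y ⟶ Y ⊠ Y) (t : X ⊠ Y ⟶ Y ⊠ X) : Prop :=
  t ≫ Δ ▷ X ≫ (α_ Y Y X).hom =
    X ◁ Δ ≫ (α_ X Y Y).inv ≫ t ▷ Y ≫ (α_ Y X Y).hom ≫ Y ◁ t

/-- The Yang–Baxter equation for three twists. -/
def YangBaxterTw {X Y A : C} (c : X ⊠ Y ⟶ Y ⊠ X) (u₁ : X ⊠ A ⟶ A ⊠ X)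
    (u₂ : Y ⊠ A ⟶ A ⊠ Y) : Prop :=
  c ▷ A ≫ (α_ Y X A).hom ≫ Y ◁ u₁ ≫ (α_ Y A X).inv ≫ u₂ ▷ X ≫ (α_ A Y X).hom =
    (α_ X Y A).hom ≫ X ◁ u₂ ≫ (α_ X A Y).inv ≫ u₁ ▷ Y ≫ (α_ A X Y).hom ≫ A ◁ c

/-- Compatibility of an action with twists. -/
def ActTw {X Y A : C} (c : X ⊠ Y ⟶ Y ⊠ X) (s : X ⊠ A ⟶ A ⊠ X) (ρ : Y ⊠ A ⟶ A) : Prop :=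
  X ◁ ρ ≫ s =
    (α_ X Y A).inv ≫ c ▷ A ≫ (α_ Y X A).hom ≫ Y ◁ s ≫ (α_ Y A X).inv ≫ ρ ▷ X

theorem hTw_assoc {X A B D : C} (t₁ : X ⊠ A ⟶ A ⊠ X) (t₂ : X ⊠ B ⟶ B ⊠ X)
    (t₃ : X ⊠ D ⟶ D ⊠ X) :
    conjTw (α_ A B D) (hTw (hTw t₁ t₂) t₃) = hTw t₁ (hTw t₂ t₃) := by
  simp only [hTw, conjTw]
  monoidal

theorem hTw_conjTw {X A B B' : C} (e : B ≅ B') (t₁ : X ⊠ A ⟶ A ⊠ X) (t₂ : X ⊠ B ⟶ B ⊠ X) :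
    hTw t₁ (conjTw e t₂) = conjTw (whiskerLeftIso A e) (hTw t₁ t₂) := by
  simp only [hTw, conjTw, whiskerLeftIso_inv, whiskerLeftIso_hom]
  calc
    _ = 𝟙 _ ⊗≫ (t₁ ▷ B' ≫ (A ⊠ X) ◁ e.inv) ⊗≫ A ◁ t₂ ⊗≫ A ◁ e.hom ▷ X ⊗≫ 𝟙 _ := by monoidal
    _ = _ := by rw [← whisker_exchange]; monoidal

theorem conjTw_conjTw {X A B D : C} (e : A ≅ B) (f : B ≅ D) (t : X ⊠ A ⟶ A ⊠ X) :
    conjTw f (conjTw e t) = conjTw (e ≪≫ f) t := by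
  simp [conjTw]

theorem conjTw_refl {X A : C} (t : X ⊠ A ⟶ A ⊠ X) : conjTw (Iso.refl A) t = t := by
  simp [conjTw]

theorem YangBaxterTw.conj {X Y A B : C} (e : A ≅ B) {c : X ⊠ Y ⟶ Y ⊠ X}
    {u₁ : X ⊠ A ⟶ A ⊠ X} {u₂ : Y ⊠ A ⟶ A ⊠ Y} (h : YangBaxterTw c u₁ u₂) :
    YangBaxterTw c (conjTw e u₁) (conjTw e u₂) := by
  unfold YangBaxterTw at *
  simp only [conjTw]
  calc
    _ = (c ▷ B ≫ (Y ⊠ X) ◁ e.inv) ⊗≫ Y ◁ u₁ ⊗≫ Y ◁ (e.hom ≫ e.inv) ▷ X ⊗≫ u₂ ▷ X ⊗≫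
        e.hom ▷ (Y ⊠ X) := by monoidal
    _ = ((X ⊠ Y) ◁ e.inv) ⊗≫ (c ▷ A ≫ (α_ Y X A).hom ≫ Y ◁ u₁ ≫ (α_ Y A X).inv ≫
        u₂ ▷ X ≫ (α_ A Y X).hom) ⊗≫ e.hom ▷ (Y ⊠ X) := by
      rw [← whisker_exchange, e.hom_inv_id]; monoidal
    _ = ((X ⊠ Y) ◁ e.inv) ⊗≫ X ◁ u₂ ⊗≫ u₁ ▷ Y ⊗≫ (A ◁ c ≫ e.hom ▷ (Y ⊠ X)) := by
      rw [h]; monoidal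
    _ = ((X ⊠ Y) ◁ e.inv) ⊗≫ X ◁ u₂ ⊗≫ X ◁ (𝟙 A) ▷ Y ⊗≫ u₁ ▷ Y ⊗≫ e.hom ▷ (X ⊠ Y) ≫
        B ◁ c := by
      rw [whisker_exchange]; monoidal
    _ = _ := by rw [← e.hom_inv_id]; monoidal

theorem YangBaxterTw.of_comp_inv {X : C} {c : X ⊠ X ⟶ X ⊠ X}
    (h : c ▷ X ≫ (α_ X X X).hom ≫ X ◁ c ≫ (α_ X X X).inv ≫ c ▷ X =
      (α_ X X X).hom ≫ X ◁ c ≫ (α_ X X X).inv ≫ c ▷ X ≫ (α_ X X X).hom ≫ X ◁ c ≫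
        (α_ X X X).inv) :
    YangBaxterTw c c c := by
  unfold YangBaxterTw
  simpa using congrArg (· ≫ (α_ X X X).hom) h

theorem YangBaxterTw.hTw {X Y A B : C} {c : X ⊠ Y ⟶ Y ⊠ X}
    {u₁ : X ⊠ A ⟶ A ⊠ X} {u₂ : Y ⊠ A ⟶ A ⊠ Y} {v₁ : X ⊠ B ⟶ B ⊠ X} {v₂ : Y ⊠ B ⟶ B ⊠ Y}
    (h : YangBaxterTw c u₁ u₂) (h' : YangBaxterTw c v₁ v₂) :
    YangBaxterTw c (hTw u₁ v₁) (hTw u₂ v₂) := by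
  unfold YangBaxterTw at *
  simp only [_root_.hTw]
  calc
    _ = 𝟙 _ ⊗≫ c ▷ (A ⊠ B) ⊗≫ Y ◁ u₁ ▷ B ⊗≫ ((Y ⊠ A) ◁ v₁ ≫ u₂ ▷ (B ⊠ X)) ⊗≫
        A ◁ v₂ ▷ X ⊗≫ 𝟙 _ := by monoidal
    _ = 𝟙 _ ⊗≫ (c ▷ A ≫ (α_ Y X A).hom ≫ Y ◁ u₁ ≫ (α_ Y A X).inv ≫ u₂ ▷ X ≫
        (α_ A Y X).hom) ▷ B ⊗≫ A ◁ (Y ◁ v₁ ⊗≫ v₂ ▷ X) ⊗≫ 𝟙 _ := by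
      rw [whisker_exchange]; monoidal
    _ = 𝟙 _ ⊗≫ X ◁ u₂ ▷ B ⊗≫ u₁ ▷ (Y ⊠ B) ⊗≫ A ◁ (c ▷ B ≫ (α_ Y X B).hom ≫ Y ◁ v₁ ≫
        (α_ Y B X).inv ≫ v₂ ▷ X ≫ (α_ B Y X).hom) ⊗≫ 𝟙 _ := by
      rw [h]; monoidal
    _ = 𝟙 _ ⊗≫ X ◁ u₂ ▷ B ⊗≫ (u₁ ▷ (Y ⊠ B) ≫ (A ⊠ X) ◁ v₂) ⊗≫ A ◁ v₁ ▷ Y ⊗≫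
        A ◁ B ◁ c ⊗≫ 𝟙 _ := by
      rw [h']; monoidal
    _ = _ := by rw [← whisker_exchange]; monoidal

theorem YangBaxterTw.vTw {X Y₁ Y₂ A : C} {c₁ : X ⊠ Y₁ ⟶ Y₁ ⊠ X} {c₂ : X ⊠ Y₂ ⟶ Y₂ ⊠ X}
    {u : X ⊠ A ⟶ A ⊠ X} {u₁ : Y₁ ⊠ A ⟶ A ⊠ Y₁} {u₂ : Y₂ ⊠ A ⟶ A ⊠ Y₂}
    (h₁ : YangBaxterTw c₁ u u₁) (h₂ : YangBaxterTw c₂ u u₂) :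
    YangBaxterTw (_root_.hTw c₁ c₂) u (vTw u₁ u₂) := by
  unfold YangBaxterTw at *
  simp only [_root_.hTw, _root_.vTw]
  calc
    _ = 𝟙 _ ⊗≫ c₁ ▷ (Y₂ ⊠ A) ⊗≫ Y₁ ◁ (c₂ ▷ A ≫ (α_ Y₂ X A).hom ≫ Y₂ ◁ u ≫
        (α_ Y₂ A X).inv ≫ u₂ ▷ X ≫ (α_ A Y₂ X).hom) ⊗≫ u₁ ▷ (Y₂ ⊠ X) ⊗≫ 𝟙 _ := by monoidal
    _ = 𝟙 _ ⊗≫ (c₁ ▷ (Y₂ ⊠ A) ≫ (Y₁ ⊠ X) ◁ u₂) ⊗≫ Y₁ ◁ u ▷ Y₂ ⊗≫ (Y₁ ⊠ A) ◁ c₂ ⊗≫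
        u₁ ▷ (Y₂ ⊠ X) ⊗≫ 𝟙 _ := by
      rw [h₂]; monoidal
    _ = 𝟙 _ ⊗≫ X ◁ Y₁ ◁ u₂ ⊗≫ c₁ ▷ A ▷ Y₂ ⊗≫ Y₁ ◁ u ▷ Y₂ ⊗≫ ((Y₁ ⊠ A) ◁ c₂ ≫
        u₁ ▷ (Y₂ ⊠ X)) ⊗≫ 𝟙 _ := by
      rw [← whisker_exchange]; monoidal
    _ = 𝟙 _ ⊗≫ X ◁ Y₁ ◁ u₂ ⊗≫ (c₁ ▷ A ≫ (α_ Y₁ X A).hom ≫ Y₁ ◁ u ≫ (α_ Y₁ A X).inv ≫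
        u₁ ▷ X ≫ (α_ A Y₁ X).hom) ▷ Y₂ ⊗≫ A ◁ Y₁ ◁ c₂ ⊗≫ 𝟙 _ := by
      rw [whisker_exchange]; monoidal
    _ = _ := by rw [h₁]; monoidal

theorem ComulTw.conj {X A B : C} (e : A ≅ B) {Δ : X ⟶ X ⊠ X} {t : X ⊠ A ⟶ A ⊠ X}
    (h : ComulTw Δ t) : ComulTw Δ (conjTw e t) := by
  unfold ComulTw at *
  simp only [conjTw]
  calc
    _ = X ◁ e.inv ⊗≫ t ⊗≫ (e.hom ▷ X ≫ B ◁ Δ) := by monoidal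
    _ = X ◁ e.inv ⊗≫ (t ≫ A ◁ Δ) ⊗≫ e.hom ▷ (X ⊠ X) := by
      rw [← whisker_exchange]; monoidal
    _ = (X ◁ e.inv ≫ Δ ▷ A) ⊗≫ X ◁ t ⊗≫ X ◁ (𝟙 A) ▷ X ⊗≫ t ▷ X ⊗≫ e.hom ▷ (X ⊠ X) := by
      rw [h]; monoidal
    _ = _ := by rw [whisker_exchange, ← e.hom_inv_id]; monoidal

theorem ComulTw.hTw {X A B : C} {Δ : X ⟶ X ⊠ X} {t₁ : X ⊠ A ⟶ A ⊠ X}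
    {t₂ : X ⊠ B ⟶ B ⊠ X} (h₁ : ComulTw Δ t₁) (h₂ : ComulTw Δ t₂) :
    ComulTw Δ (hTw t₁ t₂) := by
  unfold ComulTw at *
  simp only [_root_.hTw]
  calc
    _ = 𝟙 _ ⊗≫ t₁ ▷ B ⊗≫ A ◁ (t₂ ≫ B ◁ Δ) ⊗≫ 𝟙 _ := by monoidal
    _ = 𝟙 _ ⊗≫ (t₁ ≫ A ◁ Δ) ▷ B ⊗≫ A ◁ X ◁ t₂ ⊗≫ A ◁ t₂ ▷ X ⊗≫ 𝟙 _ := by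
      rw [h₂]; monoidal
    _ = 𝟙 _ ⊗≫ Δ ▷ (A ⊠ B) ⊗≫ X ◁ t₁ ▷ B ⊗≫ (t₁ ▷ (X ⊠ B) ≫ (A ⊠ X) ◁ t₂) ⊗≫
        A ◁ t₂ ▷ X ⊗≫ 𝟙 _ := by
      rw [h₁]; monoidal
    _ = _ := by rw [← whisker_exchange]; monoidal

theorem ComulTw.vTw {X Y A : C} {ΔX : X ⟶ X ⊠ X} {ΔY : Y ⟶ Y ⊠ Y} {c : X ⊠ Y ⟶ Y ⊠ X}
    {u₁ : X ⊠ A ⟶ A ⊠ X} {u₂ : Y ⊠ A ⟶ A ⊠ Y} (h₁ : ComulTw ΔX u₁) (h₂ : ComulTw ΔY u₂)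
    (h : YangBaxterTw c u₁ u₂) : ComulTw (braidComul c ΔX ΔY) (vTw u₁ u₂) := by
  unfold ComulTw at *
  unfold YangBaxterTw at h
  simp only [_root_.vTw, braidComul]
  calc
    _ = 𝟙 _ ⊗≫ X ◁ u₂ ⊗≫ (u₁ ≫ A ◁ ΔX) ▷ Y ⊗≫ (A ⊠ X ⊠ X) ◁ ΔY ⊗≫
        A ◁ X ◁ c ▷ Y ⊗≫ 𝟙 _ := by monoidal
    _ = 𝟙 _ ⊗≫ X ◁ u₂ ⊗≫ ((ΔX ▷ A ⊗≫ X ◁ u₁ ⊗≫ u₁ ▷ X ⊗≫ 𝟙 (A ⊠ (X ⊠ X))) ▷ Y ≫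
        (A ⊠ X ⊠ X) ◁ ΔY) ⊗≫ A ◁ X ◁ c ▷ Y ⊗≫ 𝟙 _ := by
      rw [h₁]; monoidal
    _ = 𝟙 _ ⊗≫ X ◁ (u₂ ≫ A ◁ ΔY) ⊗≫ (ΔX ▷ A ⊗≫ X ◁ u₁ ⊗≫ u₁ ▷ X) ▷ (Y ⊠ Y) ⊗≫
        A ◁ X ◁ c ▷ Y ⊗≫ 𝟙 _ := by
      rw [← whisker_exchange]; monoidal
    _ = 𝟙 _ ⊗≫ X ◁ ΔY ▷ A ⊗≫ (X ◁ (Y ◁ u₂ ⊗≫ u₂ ▷ Y ⊗≫ 𝟙 (A ⊠ (Y ⊠ Y))) ≫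
        ΔX ▷ (A ⊠ Y ⊠ Y)) ⊗≫ X ◁ u₁ ▷ (Y ⊠ Y) ⊗≫ u₁ ▷ X ▷ (Y ⊠ Y) ⊗≫
        A ◁ X ◁ c ▷ Y ⊗≫ 𝟙 _ := by
      rw [h₂]; monoidal
    _ = 𝟙 _ ⊗≫ X ◁ ΔY ▷ A ⊗≫ ΔX ▷ (Y ⊠ Y ⊠ A) ⊗≫ X ◁ X ◁ (Y ◁ u₂ ⊗≫ u₂ ▷ Y) ⊗≫
        X ◁ u₁ ▷ (Y ⊠ Y) ⊗≫ (u₁ ▷ ((X ⊠ Y) ⊠ Y) ≫ (A ⊠ X) ◁ c ▷ Y) ⊗≫ 𝟙 _ := by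
      rw [whisker_exchange]; monoidal
    _ = 𝟙 _ ⊗≫ (X ◁ ΔY ≫ ΔX ▷ (Y ⊠ Y)) ▷ A ⊗≫ X ◁ X ◁ Y ◁ u₂ ⊗≫
        X ◁ ((α_ X Y A).hom ≫ X ◁ u₂ ≫ (α_ X A Y).inv ≫ u₁ ▷ Y ≫ (α_ A X Y).hom ≫
          A ◁ c) ▷ Y ⊗≫ u₁ ▷ (Y ⊠ X ⊠ Y) ⊗≫ 𝟙 _ := by
      rw [← whisker_exchange]; monoidal
    _ = 𝟙 _ ⊗≫ (X ◁ ΔY ≫ ΔX ▷ (Y ⊠ Y)) ▷ A ⊗≫ X ◁ ((X ⊠ Y) ◁ u₂ ≫ c ▷ (A ⊠ Y)) ⊗≫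
        X ◁ Y ◁ u₁ ▷ Y ⊗≫ X ◁ u₂ ▷ X ▷ Y ⊗≫ u₁ ▷ (Y ⊠ X ⊠ Y) ⊗≫ 𝟙 _ := by
      rw [← h]; monoidal
    _ = _ := by
      rw [whisker_exchange, whisker_exchange]; monoidal

theorem TwComul.hTw {X Y₁ Y₂ : C} {Δ₁ : Y₁ ⟶ Y₁ ⊠ Y₁} {Δ₂ : Y₂ ⟶ Y₂ ⊠ Y₂}
    {c : Y₁ ⊠ Y₂ ⟶ Y₂ ⊠ Y₁} {c₁ : X ⊠ Y₁ ⟶ Y₁ ⊠ X} {c₂ : X ⊠ Y₂ ⟶ Y₂ ⊠ X}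
    (h₁ : TwComul Δ₁ c₁) (h₂ : TwComul Δ₂ c₂) (h : YangBaxterTw c₁ c₂ c) :
    TwComul (braidComul c Δ₁ Δ₂) (hTw c₁ c₂) := by
  unfold TwComul at *
  unfold YangBaxterTw at h
  simp only [_root_.hTw, braidComul]
  calc
    _ = 𝟙 _ ⊗≫ c₁ ▷ Y₂ ⊗≫ Y₁ ◁ (c₂ ≫ Δ₂ ▷ X ≫ (α_ Y₂ Y₂ X).hom) ⊗≫
        Δ₁ ▷ (Y₂ ⊠ Y₂ ⊠ X) ⊗≫ Y₁ ◁ c ▷ (Y₂ ⊠ X) ⊗≫ 𝟙 _ := by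
      rw [← whisker_exchange]; monoidal
    _ = 𝟙 _ ⊗≫ c₁ ▷ Y₂ ⊗≫ (Y₁ ◁ (X ◁ Δ₂ ⊗≫ c₂ ▷ Y₂ ⊗≫ Y₂ ◁ c₂) ≫
        Δ₁ ▷ (Y₂ ⊠ Y₂ ⊠ X)) ⊗≫ Y₁ ◁ c ▷ (Y₂ ⊠ X) ⊗≫ 𝟙 _ := by
      rw [h₂]; monoidal
    _ = 𝟙 _ ⊗≫ (c₁ ≫ Δ₁ ▷ X ≫ (α_ Y₁ Y₁ X).hom) ▷ Y₂ ⊗≫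
        (Y₁ ⊠ Y₁) ◁ (X ◁ Δ₂ ⊗≫ c₂ ▷ Y₂ ⊗≫ Y₂ ◁ c₂) ⊗≫ Y₁ ◁ c ▷ (Y₂ ⊠ X) ⊗≫ 𝟙 _ := by
      rw [whisker_exchange]; monoidal
    _ = 𝟙 _ ⊗≫ X ◁ Δ₁ ▷ Y₂ ⊗≫ ((c₁ ▷ Y₁ ⊗≫ Y₁ ◁ c₁) ▷ Y₂ ≫ (Y₁ ⊠ (Y₁ ⊠ X)) ◁ Δ₂) ⊗≫
        Y₁ ◁ Y₁ ◁ c₂ ▷ Y₂ ⊗≫ Y₁ ◁ ((Y₁ ⊠ Y₂) ◁ c₂ ≫ c ▷ (Y₂ ⊠ X)) ⊗≫ 𝟙 _ := by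
      rw [h₁]; monoidal
    _ = 𝟙 _ ⊗≫ X ◁ Δ₁ ▷ Y₂ ⊗≫ X ◁ (Y₁ ⊠ Y₁) ◁ Δ₂ ⊗≫ c₁ ▷ Y₁ ▷ (Y₂ ⊠ Y₂) ⊗≫
        Y₁ ◁ (c₁ ▷ Y₂ ≫ (α_ Y₁ X Y₂).hom ≫ Y₁ ◁ c₂ ≫ (α_ Y₁ Y₂ X).inv ≫ c ▷ X ≫
          (α_ Y₂ Y₁ X).hom) ▷ Y₂ ⊗≫ Y₁ ◁ Y₂ ◁ Y₁ ◁ c₂ ⊗≫ 𝟙 _ := by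
      rw [whisker_exchange c, ← whisker_exchange]; monoidal
    _ = 𝟙 _ ⊗≫ X ◁ Δ₁ ▷ Y₂ ⊗≫ X ◁ (Y₁ ⊠ Y₁) ◁ Δ₂ ⊗≫ (c₁ ▷ ((Y₁ ⊠ Y₂) ⊠ Y₂) ≫ (Y₁ ⊠ X) ◁ c ▷ Y₂) ⊗≫
        Y₁ ◁ c₂ ▷ Y₁ ▷ Y₂ ⊗≫ Y₁ ◁ Y₂ ◁ c₁ ▷ Y₂ ⊗≫ Y₁ ◁ Y₂ ◁ Y₁ ◁ c₂ ⊗≫ 𝟙 _ := by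
      rw [h]; monoidal
    _ = _ := by rw [← whisker_exchange]; monoidal

theorem IsCoassoc.braidComul {X Y : C} {ΔX : X ⟶ X ⊠ X} {ΔY : Y ⟶ Y ⊠ Y}
    {c : X ⊠ Y ⟶ Y ⊠ X} (hX : IsCoassoc ΔX) (hY : IsCoassoc ΔY) (h₁ : ComulTw ΔX c)
    (h₂ : TwComul ΔY c) : IsCoassoc (braidComul c ΔX ΔY) := by
  unfold IsCoassoc at *
  unfold ComulTw at h₁
  unfold TwComul at h₂
  simp only [_root_.braidComul]
  calc
    _ = 𝟙 _ ⊗≫ ΔX ▷ Y ⊗≫ X ◁ X ◁ ΔY ⊗≫ X ◁ c ▷ Y ⊗≫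
        (ΔX ▷ Y ≫ (X ⊠ X) ◁ ΔY) ▷ (X ⊠ Y) ⊗≫ X ◁ c ▷ (Y ⊠ X ⊠ Y) ⊗≫ 𝟙 _ := by monoidal
    _ = 𝟙 _ ⊗≫ ΔX ▷ Y ⊗≫ X ◁ X ◁ ΔY ⊗≫ X ◁ (c ≫ ΔY ▷ X ≫ (α_ Y Y X).hom) ▷ Y ⊗≫
        ΔX ▷ ((Y ⊠ (Y ⊠ X)) ⊠ Y) ⊗≫ X ◁ c ▷ (Y ⊠ X ⊠ Y) ⊗≫ 𝟙 _ := by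
      rw [← whisker_exchange]; monoidal
    _ = 𝟙 _ ⊗≫ ΔX ▷ Y ⊗≫ (X ◁ (X ◁ ΔY ⊗≫ (X ◁ ΔY ⊗≫ c ▷ Y ⊗≫ Y ◁ c) ▷ Y) ≫
        ΔX ▷ ((Y ⊠ (Y ⊠ X)) ⊠ Y)) ⊗≫ X ◁ c ▷ (Y ⊠ X ⊠ Y) ⊗≫ 𝟙 _ := by
      rw [h₂]; monoidal
    _ = 𝟙 _ ⊗≫ (ΔX ≫ ΔX ▷ X ≫ (α_ X X X).hom) ▷ Y ⊗≫ X ◁ X ◁ X ◁ ΔY ⊗≫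
        (X ⊠ X) ◁ (X ◁ ΔY ⊗≫ c ▷ Y ⊗≫ Y ◁ c) ▷ Y ⊗≫ X ◁ c ▷ (Y ⊠ X ⊠ Y) ⊗≫ 𝟙 _ := by
      rw [whisker_exchange]; monoidal
    _ = 𝟙 _ ⊗≫ (ΔX ≫ X ◁ ΔX) ▷ Y ⊗≫ (X ⊠ X ⊠ X) ◁ (ΔY ≫ ΔY ▷ Y ≫ (α_ Y Y Y).hom) ⊗≫
        (X ⊠ X) ◁ c ▷ (Y ⊠ Y) ⊗≫ X ◁ ((X ⊠ Y) ◁ c ≫ c ▷ (Y ⊠ X)) ▷ Y ⊗≫ 𝟙 _ := by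
      rw [hX]; monoidal
    _ = 𝟙 _ ⊗≫ ΔX ▷ Y ⊗≫ ((X ◁ ΔX) ▷ Y ≫ (X ⊠ (X ⊠ X)) ◁ ΔY) ⊗≫
        ((X ⊠ X ⊠ X) ⊠ Y) ◁ ΔY ⊗≫ X ◁ (X ◁ c ⊗≫ c ▷ X) ▷ (Y ⊠ Y) ⊗≫
        X ◁ Y ◁ X ◁ c ▷ Y ⊗≫ 𝟙 _ := by
      rw [hY, whisker_exchange]; monoidal
    _ = 𝟙 _ ⊗≫ ΔX ▷ Y ⊗≫ (X ⊠ X) ◁ ΔY ⊗≫ X ◁ ΔX ▷ (Y ⊠ Y) ⊗≫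
        (((X ⊠ X ⊠ X) ⊠ Y) ◁ ΔY ≫
          (𝟙 _ ⊗≫ X ◁ (X ◁ c ⊗≫ c ▷ X ⊗≫ 𝟙 (Y ⊠ (X ⊠ X)))) ▷ (Y ⊠ Y)) ⊗≫
        X ◁ Y ◁ X ◁ c ▷ Y ⊗≫ 𝟙 _ := by
      rw [← whisker_exchange]; monoidal
    _ = 𝟙 _ ⊗≫ ΔX ▷ Y ⊗≫ (X ⊠ X) ◁ ΔY ⊗≫
        X ◁ (ΔX ▷ Y ≫ (α_ X X Y).hom ≫ X ◁ c ≫ (α_ X Y X).inv ≫ c ▷ X ≫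
          (α_ Y X X).hom) ▷ Y ⊗≫ (X ⊠ (Y ⊠ (X ⊠ X))) ◁ ΔY ⊗≫
        X ◁ Y ◁ X ◁ c ▷ Y ⊗≫ 𝟙 _ := by
      rw [whisker_exchange]; monoidal
    _ = _ := by rw [← h₁]; monoidal

theorem hTw_chiTw {X A B : C} {Δ : X ⟶ X ⊠ X} {s₁ : X ⊠ A ⟶ A ⊠ X} {s₂ : X ⊠ B ⟶ B ⊠ X}
    {ρ₁ : X ⊠ A ⟶ A} {ρ₂ : X ⊠ B ⟶ B} (hΔ : IsCoassoc Δ) (h : ComulTw Δ s₁) :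
    hTw (chiTw Δ s₁ ρ₁) (chiTw Δ s₂ ρ₂) = chiTw Δ (hTw s₁ s₂) (hAct Δ s₁ ρ₁ ρ₂) := by
  unfold IsCoassoc at hΔ
  unfold ComulTw at h
  simp only [hTw, chiTw, hAct]
  calc
    _ = 𝟙 _ ⊗≫ Δ ▷ (A ⊠ B) ⊗≫ X ◁ s₁ ▷ B ⊗≫ (ρ₁ ▷ (X ⊠ B) ≫ A ◁ Δ ▷ B) ⊗≫
        A ◁ X ◁ s₂ ⊗≫ A ◁ ρ₂ ▷ X ⊗≫ 𝟙 _ := by monoidal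
    _ = 𝟙 _ ⊗≫ Δ ▷ (A ⊠ B) ⊗≫ X ◁ (s₁ ≫ A ◁ Δ) ▷ B ⊗≫ (ρ₁ ▷ ((X ⊠ X) ⊠ B) ≫
        A ◁ (𝟙 _ ⊗≫ X ◁ s₂)) ⊗≫ A ◁ ρ₂ ▷ X ⊗≫ 𝟙 _ := by
      rw [← whisker_exchange]; monoidal
    _ = 𝟙 _ ⊗≫ (Δ ≫ X ◁ Δ) ▷ (A ⊠ B) ⊗≫ X ◁ X ◁ s₁ ▷ B ⊗≫
        X ◁ (s₁ ▷ (X ⊠ B) ≫ (A ⊠ X) ◁ s₂) ⊗≫ ρ₁ ▷ (X ⊠ B ⊠ X) ⊗≫ A ◁ ρ₂ ▷ X ⊗≫ 𝟙 _ := by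
      rw [← whisker_exchange, h]; monoidal
    _ = 𝟙 _ ⊗≫ Δ ▷ (A ⊠ B) ⊗≫ (Δ ▷ (X ⊠ (A ⊠ B)) ≫ (X ⊠ X) ◁ (𝟙 _ ⊗≫ s₁ ▷ B ⊗≫ A ◁ s₂)) ⊗≫
        X ◁ s₁ ▷ (B ⊠ X) ⊗≫ ρ₁ ▷ (X ⊠ B ⊠ X) ⊗≫ A ◁ ρ₂ ▷ X ⊗≫ 𝟙 _ := by
      rw [← hΔ, ← whisker_exchange]; monoidal
    _ = _ := by rw [← whisker_exchange]; monoidal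

theorem conjTw_chiTw {X A B : C} (e : A ≅ B) (Δ : X ⟶ X ⊠ X) (s : X ⊠ A ⟶ A ⊠ X)
    (ρ : X ⊠ A ⟶ A) :
    conjTw e (chiTw Δ s ρ) = chiTw Δ (conjTw e s) (conjAct e ρ) := by
  simp only [conjTw, chiTw, conjAct]
  calc
    _ = (X ◁ e.inv ≫ Δ ▷ A) ⊗≫ X ◁ s ⊗≫ X ◁ (𝟙 A) ▷ X ⊗≫ ρ ▷ X ⊗≫ e.hom ▷ X := by monoidal
    _ = _ := by rw [whisker_exchange, ← e.hom_inv_id]; monoidal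

theorem vTw_chiTw {X Y A : C} {ΔX : X ⟶ X ⊠ X} {ΔY : Y ⟶ Y ⊠ Y} {c : X ⊠ Y ⟶ Y ⊠ X}
    {s₁ : X ⊠ A ⟶ A ⊠ X} {s₂ : Y ⊠ A ⟶ A ⊠ Y} {ρ₁ : X ⊠ A ⟶ A} {ρ₂ : Y ⊠ A ⟶ A}
    (h : ActTw c s₁ ρ₂) :
    vTw (chiTw ΔX s₁ ρ₁) (chiTw ΔY s₂ ρ₂) =
      chiTw (braidComul c ΔX ΔY) (vTw s₁ s₂) (vAct ρ₁ ρ₂) := by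
  unfold ActTw at h
  simp only [vTw, chiTw, vAct, braidComul]
  calc
    _ = 𝟙 _ ⊗≫ (X ◁ (ΔY ▷ A ⊗≫ Y ◁ s₂ ⊗≫ ρ₂ ▷ Y) ≫ ΔX ▷ (A ⊠ Y)) ⊗≫
        X ◁ s₁ ▷ Y ⊗≫ ρ₁ ▷ (X ⊠ Y) ⊗≫ 𝟙 _ := by monoidal
    _ = 𝟙 _ ⊗≫ (ΔX ▷ Y ≫ (X ⊠ X) ◁ ΔY) ▷ A ⊗≫ X ◁ X ◁ Y ◁ s₂ ⊗≫
        X ◁ (X ◁ ρ₂ ≫ s₁) ▷ Y ⊗≫ ρ₁ ▷ (X ⊠ Y) ⊗≫ 𝟙 _ := by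
      rw [whisker_exchange]; monoidal
    _ = 𝟙 _ ⊗≫ (ΔX ▷ Y ≫ (X ⊠ X) ◁ ΔY) ▷ A ⊗≫ X ◁ ((X ⊠ Y) ◁ s₂ ≫ c ▷ (A ⊠ Y)) ⊗≫
        X ◁ Y ◁ s₁ ▷ Y ⊗≫ X ◁ ρ₂ ▷ X ▷ Y ⊗≫ ρ₁ ▷ (X ⊠ Y) ⊗≫ 𝟙 _ := by
      rw [h]; monoidal
    _ = _ := by rw [whisker_exchange]; monoidal

theorem ActTw.conj {X Y A B : C} (e : A ≅ B) {c : X ⊠ Y ⟶ Y ⊠ X} {s : X ⊠ A ⟶ A ⊠ X}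
    {ρ : Y ⊠ A ⟶ A} (h : ActTw c s ρ) : ActTw c (conjTw e s) (conjAct e ρ) := by
  unfold ActTw at *
  simp only [conjTw, conjAct]
  calc
    _ = X ◁ Y ◁ e.inv ⊗≫ X ◁ ρ ⊗≫ X ◁ (e.hom ≫ e.inv) ⊗≫ s ≫ e.hom ▷ X := by monoidal
    _ = X ◁ Y ◁ e.inv ⊗≫ (X ◁ ρ ≫ s) ≫ e.hom ▷ X := by rw [e.hom_inv_id]; monoidal
    _ = 𝟙 _ ⊗≫ ((X ⊠ Y) ◁ e.inv ≫ c ▷ A) ⊗≫ Y ◁ s ⊗≫ Y ◁ (𝟙 A) ▷ X ⊗≫ ρ ▷ X ⊗≫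
        e.hom ▷ X := by
      rw [h]; monoidal
    _ = _ := by rw [whisker_exchange, ← e.hom_inv_id]; monoidal

theorem ActTw.hTw {X Y A B : C} {c : X ⊠ Y ⟶ Y ⊠ X} {Δ : Y ⟶ Y ⊠ Y}
    {s₁ : X ⊠ A ⟶ A ⊠ X} {s₂ : X ⊠ B ⟶ B ⊠ X} {t : Y ⊠ A ⟶ A ⊠ Y} {ρ₁ : Y ⊠ A ⟶ A}
    {ρ₂ : Y ⊠ B ⟶ B} (h₁ : ActTw c s₁ ρ₁) (h₂ : ActTw c s₂ ρ₂) (hc : YangBaxterTw c s₁ t)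
    (hΔ : TwComul Δ c) : ActTw c (hTw s₁ s₂) (hAct Δ t ρ₁ ρ₂) := by
  unfold ActTw at *
  unfold YangBaxterTw at hc
  unfold TwComul at hΔ
  simp only [_root_.hTw, hAct]
  calc
    _ = 𝟙 _ ⊗≫ X ◁ Δ ▷ (A ⊠ B) ⊗≫ X ◁ Y ◁ t ▷ B ⊗≫ X ◁ ρ₁ ▷ (Y ⊠ B) ⊗≫
        ((X ⊠ A) ◁ ρ₂ ≫ s₁ ▷ B) ⊗≫ A ◁ s₂ ⊗≫ 𝟙 _ := by monoidal
    _ = 𝟙 _ ⊗≫ X ◁ Δ ▷ (A ⊠ B) ⊗≫ X ◁ Y ◁ t ▷ B ⊗≫ (X ◁ ρ₁ ≫ s₁) ▷ (Y ⊠ B) ⊗≫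
        A ◁ (X ◁ ρ₂ ≫ s₂) ⊗≫ 𝟙 _ := by
      rw [whisker_exchange]; monoidal
    _ = 𝟙 _ ⊗≫ X ◁ Δ ▷ (A ⊠ B) ⊗≫ ((X ⊠ Y) ◁ t ▷ B ≫ c ▷ ((A ⊠ Y) ⊠ B)) ⊗≫
        Y ◁ s₁ ▷ (Y ⊠ B) ⊗≫ (ρ₁ ▷ (X ⊠ (Y ⊠ B)) ≫ A ◁ (𝟙 _ ⊗≫ c ▷ B ⊗≫ Y ◁ s₂)) ⊗≫
        A ◁ ρ₂ ▷ X ⊗≫ 𝟙 _ := by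
      rw [h₁, h₂]; monoidal
    _ = 𝟙 _ ⊗≫ X ◁ Δ ▷ (A ⊠ B) ⊗≫ c ▷ ((Y ⊠ A) ⊠ B) ⊗≫
        Y ◁ ((α_ X Y A).hom ≫ X ◁ t ≫ (α_ X A Y).inv ≫ s₁ ▷ Y ≫ (α_ A X Y).hom ≫
          A ◁ c) ▷ B ⊗≫ Y ◁ A ◁ Y ◁ s₂ ⊗≫ ρ₁ ▷ (Y ⊠ B ⊠ X) ⊗≫ A ◁ ρ₂ ▷ X ⊗≫ 𝟙 _ := by
      rw [← whisker_exchange, whisker_exchange]; monoidal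
    _ = 𝟙 _ ⊗≫ (X ◁ Δ ≫ (α_ X Y Y).inv ≫ c ▷ Y ≫ (α_ Y X Y).hom ≫ Y ◁ c) ▷ (A ⊠ B) ⊗≫
        Y ◁ Y ◁ s₁ ▷ B ⊗≫ Y ◁ (t ▷ (X ⊠ B) ≫ (A ⊠ Y) ◁ s₂) ⊗≫ ρ₁ ▷ (Y ⊠ B ⊠ X) ⊗≫
        A ◁ ρ₂ ▷ X ⊗≫ 𝟙 _ := by
      rw [← hc]; monoidal
    _ = 𝟙 _ ⊗≫ c ▷ (A ⊠ B) ⊗≫ (Δ ▷ (X ⊠ (A ⊠ B)) ≫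
          (Y ⊠ Y) ◁ (𝟙 _ ⊗≫ s₁ ▷ B ⊗≫ A ◁ s₂)) ⊗≫ Y ◁ t ▷ (B ⊠ X) ⊗≫
        ρ₁ ▷ (Y ⊠ B ⊠ X) ⊗≫ A ◁ ρ₂ ▷ X ⊗≫ 𝟙 _ := by
      rw [← hΔ, ← whisker_exchange]; monoidal
    _ = _ := by rw [← whisker_exchange]; monoidal

theorem ActTw.vAct {X Y₁ Y₂ A : C} {c₁ : X ⊠ Y₁ ⟶ Y₁ ⊠ X} {c₂ : X ⊠ Y₂ ⟶ Y₂ ⊠ X}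
    {s : X ⊠ A ⟶ A ⊠ X} {ρ₁ : Y₁ ⊠ A ⟶ A} {ρ₂ : Y₂ ⊠ A ⟶ A} (h₁ : ActTw c₁ s ρ₁)
    (h₂ : ActTw c₂ s ρ₂) : ActTw (_root_.hTw c₁ c₂) s (vAct ρ₁ ρ₂) := by
  unfold ActTw at *
  simp only [_root_.hTw, _root_.vAct]
  calc
    _ = 𝟙 _ ⊗≫ X ◁ Y₁ ◁ ρ₂ ⊗≫ (X ◁ ρ₁ ≫ s) ⊗≫ 𝟙 _ := by monoidal
    _ = 𝟙 _ ⊗≫ ((X ⊠ Y₁) ◁ ρ₂ ≫ c₁ ▷ A) ⊗≫ Y₁ ◁ s ⊗≫ ρ₁ ▷ X ⊗≫ 𝟙 _ := by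
      rw [h₁]; monoidal
    _ = 𝟙 _ ⊗≫ c₁ ▷ (Y₂ ⊠ A) ⊗≫ Y₁ ◁ (X ◁ ρ₂ ≫ s) ⊗≫ ρ₁ ▷ X ⊗≫ 𝟙 _ := by
      rw [whisker_exchange]; monoidal
    _ = _ := by rw [h₂]; monoidal

/-- The comodule-type identity relating `chiTw` to an invertible twist. -/
theorem comul_chiTw_inv {X A : C} {Δ : X ⟶ X ⊠ X} (s : X ⊠ A ≅ A ⊠ X) (ρ : X ⊠ A ⟶ A)
    (hΔ : IsCoassoc Δ) (h : ComulTw Δ s.hom) :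
    s.inv ≫ Δ ▷ A ≫ (α_ X X A).hom ≫ X ◁ chiTw Δ s.hom ρ =
      A ◁ Δ ≫ (α_ A X X).inv ≫ s.inv ▷ X ≫ (Δ ▷ A) ▷ X ≫ (α_ X X A).hom ▷ X ≫
        (X ◁ ρ) ▷ X ≫ (α_ X A X).hom := by
  unfold IsCoassoc at hΔ
  unfold ComulTw at h
  rw [Iso.inv_comp_eq, ← Category.assoc s.hom, h]
  simp only [chiTw]
  calc
    _ = 𝟙 _ ⊗≫ (Δ ≫ X ◁ Δ) ▷ A ⊗≫ X ◁ X ◁ s.hom ⊗≫ X ◁ ρ ▷ X ⊗≫ 𝟙 _ := by monoidal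
    _ = 𝟙 _ ⊗≫ Δ ▷ A ⊗≫ (Δ ▷ (X ⊠ A) ≫ (X ⊠ X) ◁ s.hom) ⊗≫ X ◁ ρ ▷ X ⊗≫ 𝟙 _ := by
      rw [← hΔ]; monoidal
    _ = Δ ▷ A ⊗≫ X ◁ s.hom ⊗≫ (𝟙 (X ⊠ A)) ▷ X ⊗≫ Δ ▷ A ▷ X ⊗≫ X ◁ ρ ▷ X ⊗≫
        𝟙 _ := by
      rw [← whisker_exchange]; monoidal
    _ = _ := by rw [← s.hom_inv_id]; monoidal


/-- The reordering `(X⊗X)⊗D → (X⊗P)⊗(X⊗P)` built from `σ : D → P⊗P` and `τ : X⊗P → P⊗X`. -/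
def shuffle {X P D : C} (τ : X ⊠ P ⟶ P ⊠ X) (σ : D ⟶ P ⊠ P) :
    (X ⊠ X) ⊠ D ⟶ (X ⊠ P) ⊠ (X ⊠ P) :=
  (X ⊠ X) ◁ σ ≫ (α_ X X (P ⊠ P)).hom ≫ X ◁ (α_ X P P).inv ≫ X ◁ τ ▷ P ≫
    X ◁ (α_ P X P).hom ≫ (α_ X P (X ⊠ P)).inv


theorem braidComul_eq_shuffle {X Y D : C} (c : X ⊠ Y ⟶ Y ⊠ X) (ΔX : X ⟶ X ⊠ X) (δ : Y ⟶ D)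
    (σ : D ⟶ Y ⊠ Y) :
    braidComul c ΔX (δ ≫ σ) = (ΔX ⊗ₘ δ) ≫ shuffle c σ := by
  simp [shuffle, braidComul, MonoidalCategory.tensorHom_def]

theorem shuffle_id {X : C} (τ : X ⊠ X ⟶ X ⊠ X) :
    shuffle τ (𝟙 (X ⊠ X)) =
      ((α_ X X (X ⊠ X)).hom ≫ X ◁ (α_ X X X).inv ≫ X ◁ τ ▷ X) ≫ X ◁ (𝟙 (X ⊠ X)) ▷ X ≫
        X ◁ (α_ X X X).hom ≫ X ◁ X ◁ 𝟙 (X ⊠ X) ≫ (α_ X X (X ⊠ X)).inv := by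
  simp [shuffle]

theorem shuffle_hTw {X P D : C} {c : X ⊠ X ⟶ X ⊠ X} {τ : X ⊠ P ⟶ P ⊠ X} {σ : D ⟶ P ⊠ P}
    {e : P ⊠ X ⟶ X ⊠ P} {m : (X ⊠ X) ⊠ D ⟶ X ⊠ (D ⊠ X)}
    {S : (X ⊠ X) ⊠ D ⟶ (X ⊠ P) ⊠ (X ⊠ P)} (hS : S = shuffle τ σ)
    (h : m ≫ X ◁ σ ▷ X ≫ X ◁ (α_ P P X).hom ≫ X ◁ P ◁ e ≫ (α_ X P (X ⊠ P)).inv = S) :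
    ((X ⊠ X) ◁ m ≫ (α_ X X (X ⊠ (D ⊠ X))).hom ≫ X ◁ (α_ X X (D ⊠ X)).inv ≫
        X ◁ c ▷ (D ⊠ X) ≫ X ◁ (α_ (X ⊠ X) D X).inv) ≫ X ◁ S ▷ X ≫
        X ◁ (α_ (X ⊠ P) (X ⊠ P) X).hom ≫ X ◁ (X ⊠ P) ◁ ((α_ X P X).hom ≫ X ◁ e) ≫
        (α_ X (X ⊠ P) (X ⊠ (X ⊠ P))).inv =
      shuffle (hTw c τ) S := by
  rw [shuffle.eq_1 (hTw c τ) S]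
  conv_rhs => rw [← h]
  rw [hS]
  simp only [shuffle, hTw]
  calc
    _ = 𝟙 _ ⊗≫ (X ⊠ X) ◁ m ⊗≫ X ◁ (c ▷ (D ⊠ X) ≫ (X ⊠ X) ◁ (σ ▷ X)) ⊗≫
        X ◁ X ◁ (τ ▷ (P ⊠ X) ≫ (P ⊠ X) ◁ e) ⊗≫ 𝟙 _ := by monoidal
    _ = 𝟙 _ ⊗≫ (X ⊠ X) ◁ m ⊗≫ X ◁ (X ⊠ X) ◁ (σ ▷ X) ⊗≫ X ◁ (c ▷ (P ⊠ P ⊠ X) ≫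
        (X ⊠ X) ◁ P ◁ e) ⊗≫ X ◁ X ◁ τ ▷ (X ⊠ P) ⊗≫ 𝟙 _ := by
      rw [← whisker_exchange, ← whisker_exchange]; monoidal
    _ = _ := by rw [← whisker_exchange]; monoidal

end MonoidalLemmas

section ModuleCatBridge

open CategoryTheory MonoidalCategory

local infixr:70 "⊠" => MonoidalCategoryStruct.tensorObj

/-- The tensor power `M^{⊗(n+1)}` as an object of `ModuleCat k`. -/
noncomputable abbrev pwObj (k M : Type u) [Field k] [AddCommGroup M] [Module k M] (n : ℕ) :
    ModuleCat.{u} k :=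
  ModuleCat.of k ↥(pw k M n)

variable {H A : Type u} [AddCommGroup H] [Module k H] [AddCommGroup A] [Module k A]

/-- `snoc` as an isomorphism of `ModuleCat k`. -/
noncomputable def snocIso (k M : Type u) [Field k] [AddCommGroup M] [Module k M] (n : ℕ) :
    pwObj k M n ⊠ ModuleCat.of k M ≅ pwObj k M (n + 1) :=
  (snoc k n).toModuleIso

/-- A linear map `H ⊗ A → A ⊗ H` as a morphism of `ModuleCat k`. -/
noncomputable abbrev homTw (t : H ⊗[k] A →ₗ[k] A ⊗[k] H) :
    ModuleCat.of k H ⊠ ModuleCat.of k A ⟶ ModuleCat.of k A ⊠ ModuleCat.of k H :=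
  ModuleCat.ofHom t

/-- `tw1` as a morphism of `ModuleCat k`. -/
noncomputable def tw1Hom (t : H ⊗[k] A →ₗ[k] A ⊗[k] H) (l : ℕ) :
    ModuleCat.of k H ⊠ pwObj k A l ⟶ pwObj k A l ⊠ ModuleCat.of k H :=
  ModuleCat.ofHom (tw1 t l)

/-- `twFull` as a morphism of `ModuleCat k`. -/
noncomputable def twFullHom (t : H ⊗[k] A →ₗ[k] A ⊗[k] H) (j l : ℕ) :
    pwObj k H j ⊠ pwObj k A l ⟶ pwObj k A l ⊠ pwObj k H j :=
  ModuleCat.ofHom (twFull t j l)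

/-- `rhoPow` as a morphism of `ModuleCat k`. -/
noncomputable def rhoPowHom (Δ : H →ₗ[k] H ⊗[k] H) (s : H ⊗[k] A ≃ₗ[k] A ⊗[k] H)
    (ρ : H ⊗[k] A →ₗ[k] A) (l : ℕ) :
    ModuleCat.of k H ⊠ pwObj k A l ⟶ pwObj k A l :=
  ModuleCat.ofHom (rhoPow Δ s ρ l)

/-- `rhoFull` as a morphism of `ModuleCat k`. -/
noncomputable def rhoFullHom (Δ : H →ₗ[k] H ⊗[k] H) (s : H ⊗[k] A ≃ₗ[k] A ⊗[k] H)
    (ρ : H ⊗[k] A →ₗ[k] A) (j l : ℕ) : pwObj k H j ⊠ pwObj k A l ⟶ pwObj k A l :=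
  ModuleCat.ofHom (rhoFull Δ s ρ j l)

/-- `cShuffle` as a morphism of `ModuleCat k`. -/
noncomputable def cShuffleHom (c : H ⊗[k] H →ₗ[k] H ⊗[k] H) (n : ℕ) :
    pwObj k (H ⊗[k] H) n ⟶ pwObj k H n ⊠ pwObj k H n :=
  ModuleCat.ofHom (cShuffle c n)

/-- `comulP` as a morphism of `ModuleCat k`. -/
noncomputable def comulPHom (c : H ⊗[k] H →ₗ[k] H ⊗[k] H) (Δ : H →ₗ[k] H ⊗[k] H) (n : ℕ) :
    pwObj k H n ⟶ pwObj k H n ⊠ pwObj k H n :=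
  ModuleCat.ofHom (comulP c Δ n)

theorem tw1Hom_succ (t : H ⊗[k] A →ₗ[k] A ⊗[k] H) (l : ℕ) :
    tw1Hom t (l + 1) = conjTw (snocIso k A l) (hTw (tw1Hom t l) (homTw t)) :=
  rfl

theorem tw1Hom_succ_left (t : H ⊗[k] A →ₗ[k] A ⊗[k] H) (l : ℕ) :
    tw1Hom t (l + 1) = hTw (homTw t) (tw1Hom t l) := by
  induction l with
  | zero =>
    exact conjTw_refl (C := ModuleCat.{u} k) (X := ModuleCat.of k H)
      (hTw (homTw t) (homTw t))
  | succ l ih =>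
    refine (congrArg (fun x => conjTw (snocIso k A (l + 1)) (hTw x (homTw t))) ih).trans ?_
    refine (conjTw_conjTw (α_ (ModuleCat.of k A) (pwObj k A l) (ModuleCat.of k A))
      (whiskerLeftIso (ModuleCat.of k A) (snocIso k A l)) _).symm.trans ?_
    refine (congrArg _ (hTw_assoc _ _ _)).trans ?_
    exact (hTw_conjTw _ _ _).symm

theorem twFullHom_succ (t : H ⊗[k] A →ₗ[k] A ⊗[k] H) (j l : ℕ) :
    twFullHom t (j + 1) l = vTw (tw1Hom t l) (twFullHom t j l) :=
  rfl

theorem twE1_toLinearMap (s : H ⊗[k] A ≃ₗ[k] A ⊗[k] H) (l : ℕ) :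
    (twE1 s l).toLinearMap = tw1 s.toLinearMap l := by
  induction l with
  | zero => rfl
  | succ l ih => rw [tw1, ← ih]; rfl

theorem twEFull_toLinearMap (s : H ⊗[k] A ≃ₗ[k] A ⊗[k] H) (j l : ℕ) :
    (twEFull s j l).toLinearMap = twFull s.toLinearMap j l := by
  induction j with
  | zero => exact twE1_toLinearMap s l
  | succ j ih => rw [twFull, ← ih, ← twE1_toLinearMap]; rfl

theorem rhoPowHom_succ (Δ : H →ₗ[k] H ⊗[k] H) (s : H ⊗[k] A ≃ₗ[k] A ⊗[k] H)
    (ρ : H ⊗[k] A →ₗ[k] A) (l : ℕ) :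
    rhoPowHom Δ s ρ (l + 1) = conjAct (snocIso k A l)
      (hAct (ModuleCat.ofHom Δ) (tw1Hom s.toLinearMap l) (rhoPowHom Δ s ρ l)
        (ModuleCat.ofHom ρ)) := by
  unfold conjAct hAct tw1Hom
  rw [← MonoidalCategory.tensorHom_def, ← twE1_toLinearMap]
  rfl

theorem rhoFullHom_succ (Δ : H →ₗ[k] H ⊗[k] H) (s : H ⊗[k] A ≃ₗ[k] A ⊗[k] H)
    (ρ : H ⊗[k] A →ₗ[k] A) (j l : ℕ) :
    rhoFullHom Δ s ρ (j + 1) l = vAct (rhoPowHom Δ s ρ l) (rhoFullHom Δ s ρ j l) :=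
  rfl

theorem cShuffleHom_succ (c : H ⊗[k] H →ₗ[k] H ⊗[k] H) (n : ℕ) :
    cShuffleHom c (n + 1) = shuffle (tw1Hom c n) (cShuffleHom c n) := by
  induction n with
  | zero =>
    exact (shuffle_id (homTw c)).symm
  | succ n ih =>
    rw [tw1Hom_succ_left]
    exact shuffle_hTw (X := ModuleCat.of k H) (P := pwObj k H n) (D := pwObj k (H ⊗[k] H) n)
      (c := homTw c) (τ := tw1Hom c n) (σ := cShuffleHom c n) (e := (snocIso k H n).hom)
      (m := ModuleCat.ofHom (X := (H ⊗[k] H) ⊗[k] ↥(pw k (H ⊗[k] H) n))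
        (Y := H ⊗[k] (↥(pw k (H ⊗[k] H) n) ⊗[k] H)) (mids c n))
      (S := cShuffleHom c (n + 1)) ih rfl

theorem comulPHom_succ (c : H ⊗[k] H →ₗ[k] H ⊗[k] H) (Δ : H →ₗ[k] H ⊗[k] H) (n : ℕ) :
    comulPHom c Δ (n + 1) = braidComul (tw1Hom c n) (ModuleCat.ofHom Δ) (comulPHom c Δ n) := by
  refine Eq.trans ?_ (braidComul_eq_shuffle (tw1Hom c n) (ModuleCat.ofHom Δ)
    (ModuleCat.ofHom (dPow Δ n) : pwObj k H n ⟶ pwObj k (H ⊗[k] H) n) (cShuffleHom c n)).symm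
  rw [← cShuffleHom_succ]
  rfl

theorem YangBaxterTw.tw1 {c : H ⊗[k] H →ₗ[k] H ⊗[k] H} {s : H ⊗[k] A →ₗ[k] A ⊗[k] H}
    (h : YangBaxterTw (homTw c) (homTw s) (homTw s)) (l : ℕ) :
    YangBaxterTw (homTw c) (tw1Hom s l) (tw1Hom s l) := by
  induction l with
  | zero => exact h
  | succ l ih =>
    rw [tw1Hom_succ]
    exact (ih.hTw h).conj _

theorem YangBaxterTw.twFull {c : H ⊗[k] H →ₗ[k] H ⊗[k] H} {s : H ⊗[k] A →ₗ[k] A ⊗[k] H}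
    (h : YangBaxterTw (homTw c) (homTw s) (homTw s)) (n l : ℕ) :
    YangBaxterTw (tw1Hom c n) (tw1Hom s l) (twFullHom s n l) := by
  induction n with
  | zero => exact h.tw1 l
  | succ n ih =>
    rw [tw1Hom_succ_left, twFullHom_succ]
    exact (h.tw1 l).vTw ih

theorem ComulTw.tw1 {Δ : H →ₗ[k] H ⊗[k] H} {s : H ⊗[k] A →ₗ[k] A ⊗[k] H}
    (h : ComulTw (X := ModuleCat.of k H) (ModuleCat.ofHom Δ) (homTw s)) (l : ℕ) :
    ComulTw (X := ModuleCat.of k H) (ModuleCat.ofHom Δ) (tw1Hom s l) := by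
  induction l with
  | zero => exact h
  | succ l ih =>
    rw [tw1Hom_succ]
    exact (ih.hTw h).conj _

theorem ComulTw.twFull {c : H ⊗[k] H →ₗ[k] H ⊗[k] H} {Δ : H →ₗ[k] H ⊗[k] H}
    {s : H ⊗[k] A →ₗ[k] A ⊗[k] H}
    (h : ComulTw (X := ModuleCat.of k H) (ModuleCat.ofHom Δ) (homTw s))
    (hc : YangBaxterTw (homTw c) (homTw s) (homTw s)) (n l : ℕ) :
    ComulTw (comulPHom c Δ n) (twFullHom s n l) := by
  induction n with
  | zero => exact h.tw1 l
  | succ n ih =>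
    rw [comulPHom_succ, twFullHom_succ]
    exact (h.tw1 l).vTw ih (hc.twFull n l)

theorem TwComul.comulP {c : H ⊗[k] H →ₗ[k] H ⊗[k] H} {Δ : H →ₗ[k] H ⊗[k] H}
    (h : TwComul (Y := ModuleCat.of k H) (ModuleCat.ofHom Δ) (homTw c))
    (hc : YangBaxterTw (homTw c) (homTw c) (homTw c)) (n : ℕ) :
    TwComul (comulPHom c Δ n) (tw1Hom c n) := by
  induction n with
  | zero => exact h
  | succ n ih =>
    rw [comulPHom_succ, tw1Hom_succ_left]
    exact h.hTw ih (hc.tw1 n)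

theorem IsCoassoc.comulP {c : H ⊗[k] H →ₗ[k] H ⊗[k] H} {Δ : H →ₗ[k] H ⊗[k] H}
    (hΔ : IsCoassoc (X := ModuleCat.of k H) (ModuleCat.ofHom Δ))
    (h₁ : ComulTw (X := ModuleCat.of k H) (ModuleCat.ofHom Δ) (homTw c))
    (h₂ : TwComul (Y := ModuleCat.of k H) (ModuleCat.ofHom Δ) (homTw c))
    (hc : YangBaxterTw (homTw c) (homTw c) (homTw c)) (n : ℕ) :
    IsCoassoc (comulPHom c Δ n) := by
  induction n with
  | zero => exact hΔ
  | succ n ih =>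
    rw [comulPHom_succ]
    exact hΔ.braidComul ih (h₁.tw1 n) (h₂.comulP hc n)

theorem ActTw.rhoPow {c : H ⊗[k] H →ₗ[k] H ⊗[k] H} {Δ : H →ₗ[k] H ⊗[k] H}
    {s : H ⊗[k] A ≃ₗ[k] A ⊗[k] H} {ρ : H ⊗[k] A →ₗ[k] A}
    (h : ActTw (homTw c) (homTw s.toLinearMap) (ModuleCat.ofHom ρ))
    (hc : YangBaxterTw (homTw c) (homTw s.toLinearMap) (homTw s.toLinearMap))
    (hΔ : TwComul (Y := ModuleCat.of k H) (ModuleCat.ofHom Δ) (homTw c)) (l : ℕ) :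
    ActTw (homTw c) (tw1Hom s.toLinearMap l) (rhoPowHom Δ s ρ l) := by
  induction l with
  | zero => exact h
  | succ l ih =>
    rw [tw1Hom_succ, rhoPowHom_succ]
    exact (ih.hTw h (hc.tw1 l) hΔ).conj _

theorem ActTw.rhoFull {c : H ⊗[k] H →ₗ[k] H ⊗[k] H} {Δ : H →ₗ[k] H ⊗[k] H}
    {s : H ⊗[k] A ≃ₗ[k] A ⊗[k] H} {ρ : H ⊗[k] A →ₗ[k] A}
    (h : ActTw (homTw c) (homTw s.toLinearMap) (ModuleCat.ofHom ρ))
    (hc : YangBaxterTw (homTw c) (homTw s.toLinearMap) (homTw s.toLinearMap))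
    (hΔ : TwComul (Y := ModuleCat.of k H) (ModuleCat.ofHom Δ) (homTw c)) (n l : ℕ) :
    ActTw (tw1Hom c n) (tw1Hom s.toLinearMap l) (rhoFullHom Δ s ρ n l) := by
  induction n with
  | zero => exact h.rhoPow hc hΔ l
  | succ n ih =>
    rw [tw1Hom_succ_left, rhoFullHom_succ]
    exact (h.rhoPow hc hΔ l).vAct ih

theorem tw1Hom_eq_chiTw {Δ : H →ₗ[k] H ⊗[k] H} {s : H ⊗[k] A ≃ₗ[k] A ⊗[k] H}
    {ρ : H ⊗[k] A →ₗ[k] A} {χ : H ⊗[k] A →ₗ[k] A ⊗[k] H}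
    (hχ : homTw χ = chiTw (ModuleCat.ofHom Δ) (homTw s.toLinearMap) (ModuleCat.ofHom ρ))
    (hΔ : IsCoassoc (X := ModuleCat.of k H) (ModuleCat.ofHom Δ))
    (h : ComulTw (X := ModuleCat.of k H) (ModuleCat.ofHom Δ) (homTw s.toLinearMap)) (l : ℕ) :
    tw1Hom χ l = chiTw (ModuleCat.ofHom Δ) (tw1Hom s.toLinearMap l) (rhoPowHom Δ s ρ l) := by
  induction l with
  | zero => exact hχ
  | succ l ih =>
    rw [tw1Hom_succ, tw1Hom_succ, ih, hχ, hTw_chiTw hΔ (h.tw1 l), conjTw_chiTw,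
      rhoPowHom_succ]

theorem twFullHom_eq_chiTw {c : H ⊗[k] H →ₗ[k] H ⊗[k] H} {Δ : H →ₗ[k] H ⊗[k] H}
    {s : H ⊗[k] A ≃ₗ[k] A ⊗[k] H} {ρ : H ⊗[k] A →ₗ[k] A} {χ : H ⊗[k] A →ₗ[k] A ⊗[k] H}
    (hχ : homTw χ = chiTw (ModuleCat.ofHom Δ) (homTw s.toLinearMap) (ModuleCat.ofHom ρ))
    (hΔ : IsCoassoc (X := ModuleCat.of k H) (ModuleCat.ofHom Δ))
    (h : ComulTw (X := ModuleCat.of k H) (ModuleCat.ofHom Δ) (homTw s.toLinearMap))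
    (hρ : ActTw (homTw c) (homTw s.toLinearMap) (ModuleCat.ofHom ρ))
    (hc : YangBaxterTw (homTw c) (homTw s.toLinearMap) (homTw s.toLinearMap))
    (hΔc : TwComul (Y := ModuleCat.of k H) (ModuleCat.ofHom Δ) (homTw c)) (n l : ℕ) :
    twFullHom χ n l =
      chiTw (comulPHom c Δ n) (twFullHom s.toLinearMap n l) (rhoFullHom Δ s ρ n l) := by
  induction n with
  | zero => exact tw1Hom_eq_chiTw hχ hΔ h l
  | succ n ih =>
    rw [twFullHom_succ, twFullHom_succ, ih, tw1Hom_eq_chiTw hχ hΔ h,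
      vTw_chiTw (hρ.rhoFull hc hΔc n l), comulPHom_succ, rhoFullHom_succ]
    rfl

/-- `twEFull` as an isomorphism of `ModuleCat k`. -/
noncomputable def twFullIso (s : H ⊗[k] A ≃ₗ[k] A ⊗[k] H) (n l : ℕ) :
    pwObj k H n ⊠ pwObj k A l ≅ pwObj k A l ⊠ pwObj k H n :=
  (twEFull s n l).toModuleIso

theorem twFullIso_hom (s : H ⊗[k] A ≃ₗ[k] A ⊗[k] H) (n l : ℕ) :
    (twFullIso s n l).hom = twFullHom s.toLinearMap n l :=
  congrArg ModuleCat.ofHom (twEFull_toLinearMap s n l)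

section Datum

variable {H A : Type u} [Ring H] [Algebra k H] [Coalgebra k H] [Ring A] [Algebra k A]

theorem isCoassoc_comul (H : Type u) [Ring H] [Algebra k H] [Coalgebra k H] :
    IsCoassoc (X := ModuleCat.of k H) (ModuleCat.ofHom (Coalgebra.comul (R := k) (A := H))) :=
  congrArg ModuleCat.ofHom (Coalgebra.coassoc (R := k) (A := H))

theorem BraidedBialgebra.yangBaxterTw (bb : BraidedBialgebra k H) :
    YangBaxterTw (homTw bb.c.toLinearMap) (homTw bb.c.toLinearMap)
      (homTw bb.c.toLinearMap) :=
  .of_comp_inv (congrArg ModuleCat.ofHom bb.yang_baxter)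

theorem BraidedBialgebra.comulTw (bb : BraidedBialgebra k H) :
    ComulTw (X := ModuleCat.of k H) (ModuleCat.ofHom (Coalgebra.comul (R := k) (A := H)))
      (homTw bb.c.toLinearMap) :=
  congrArg ModuleCat.ofHom bb.braid_comul_right

theorem BraidedBialgebra.twComul (bb : BraidedBialgebra k H) :
    TwComul (Y := ModuleCat.of k H) (ModuleCat.ofHom (Coalgebra.comul (R := k) (A := H)))
      (homTw bb.c.toLinearMap) :=
  congrArg ModuleCat.ofHom bb.braid_comul_left

variable {c : H ⊗[k] H ≃ₗ[k] H ⊗[k] H}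

theorem Transposition.yangBaxterTw (tr : Transposition k c A) :
    YangBaxterTw (homTw c.toLinearMap) (homTw tr.s.toLinearMap) (homTw tr.s.toLinearMap) :=
  congrArg ModuleCat.ofHom tr.s_braid

theorem Transposition.comulTw (tr : Transposition k c A) :
    ComulTw (X := ModuleCat.of k H) (ModuleCat.ofHom (Coalgebra.comul (R := k) (A := H)))
      (homTw tr.s.toLinearMap) :=
  congrArg ModuleCat.ofHom tr.s_comul

theorem WeakSAction.actTw {s : H ⊗[k] A ≃ₗ[k] A ⊗[k] H} (wa : WeakSAction k c s) :
    ActTw (homTw c.toLinearMap) (homTw s.toLinearMap) (ModuleCat.ofHom wa.ρ) :=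
  congrArg ModuleCat.ofHom wa.rho_s

theorem homTw_chi (s : H ⊗[k] A →ₗ[k] A ⊗[k] H) (ρ : H ⊗[k] A →ₗ[k] A) :
    homTw (chi s ρ) = chiTw (ModuleCat.ofHom (Coalgebra.comul (R := k) (A := H))) (homTw s)
      (ModuleCat.ofHom ρ) :=
  rfl

/-- The main identity, as an equality of morphisms of `ModuleCat k`. -/
theorem twFullIso_inv_comulPHom (bb : BraidedBialgebra k H) (tr : Transposition k bb.c A)
    (wa : WeakSAction k bb.c tr.s) (n r : ℕ) :
    (twFullIso tr.s n r).inv ≫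
        comulPHom bb.c.toLinearMap (Coalgebra.comul (R := k) (A := H)) n ▷ pwObj k A r ≫
        (α_ (pwObj k H n) (pwObj k H n) (pwObj k A r)).hom ≫
        pwObj k H n ◁ twFullHom (chi tr.s.toLinearMap wa.ρ) n r =
      pwObj k A r ◁ comulPHom bb.c.toLinearMap (Coalgebra.comul (R := k) (A := H)) n ≫
        (α_ (pwObj k A r) (pwObj k H n) (pwObj k H n)).inv ≫
        (twFullIso tr.s n r).inv ▷ pwObj k H n ≫
        (comulPHom bb.c.toLinearMap (Coalgebra.comul (R := k) (A := H)) n ▷ pwObj k A r) ▷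
          pwObj k H n ≫
        (α_ (pwObj k H n) (pwObj k H n) (pwObj k A r)).hom ▷ pwObj k H n ≫
        (pwObj k H n ◁ rhoFullHom (Coalgebra.comul (R := k) (A := H)) tr.s wa.ρ n r) ▷
          pwObj k H n ≫
        (α_ (pwObj k H n) (pwObj k A r) (pwObj k H n)).hom := by
  rw [twFullHom_eq_chiTw (homTw_chi tr.s.toLinearMap wa.ρ) (isCoassoc_comul H) tr.comulTw
    wa.actTw tr.yangBaxterTw bb.twComul n r, ← twFullIso_hom]
  refine comul_chiTw_inv _ _
    ((isCoassoc_comul H).comulP bb.comulTw bb.twComul bb.yangBaxterTw n) ?_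
  rw [twFullIso_hom]
  exact ComulTw.twFull tr.comulTw tr.yangBaxterTw n r

end Datum

end ModuleCatBridge

/-- `(id⊗χ_{n,r})∘(Δ_n⊗id)∘𝔰_{n,r}⁻¹ = (id⊗ρ_{n,r}⊗id)∘(Δ_n⊗id⊗id)∘(𝔰_{n,r}⁻¹⊗id)∘(id⊗Δ_n)`. -/
theorem chiFull_comul_sInv_eq {H A : Type u} [Ring H] [Algebra k H] [Coalgebra k H]
    [Ring A] [Algebra k A]
    (bb : BraidedBialgebra k H) (tr : Transposition k bb.c A)
    (wa : WeakSAction k bb.c tr.s) :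
    ∀ n r : ℕ,
      LinearMap.lTensor ↥(pw k H n) (twFull (chi tr.s.toLinearMap wa.ρ) n r)
          ∘ₗ (TensorProduct.assoc k ↥(pw k H n) ↥(pw k H n) ↥(pw k A r)).toLinearMap
          ∘ₗ LinearMap.rTensor ↥(pw k A r)
              (comulP bb.c.toLinearMap (Coalgebra.comul (R := k) (A := H)) n)
          ∘ₗ (twEFull tr.s n r).symm.toLinearMap
        = (TensorProduct.assoc k ↥(pw k H n) ↥(pw k A r) ↥(pw k H n)).toLinearMap
          ∘ₗ LinearMap.rTensor ↥(pw k H n)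
              (LinearMap.lTensor ↥(pw k H n)
                (rhoFull (Coalgebra.comul (R := k) (A := H)) tr.s wa.ρ n r))
          ∘ₗ LinearMap.rTensor ↥(pw k H n)
              (TensorProduct.assoc k ↥(pw k H n) ↥(pw k H n) ↥(pw k A r)).toLinearMap
          ∘ₗ LinearMap.rTensor ↥(pw k H n)
              (LinearMap.rTensor ↥(pw k A r)
                (comulP bb.c.toLinearMap (Coalgebra.comul (R := k) (A := H)) n))
          ∘ₗ LinearMap.rTensor ↥(pw k H n) (twEFull tr.s n r).symm.toLinearMap
          ∘ₗ (TensorProduct.assoc k ↥(pw k A r) ↥(pw k H n) ↥(pw k H n)).symm.toLinearMap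
          ∘ₗ LinearMap.lTensor ↥(pw k A r)
              (comulP bb.c.toLinearMap (Coalgebra.comul (R := k) (A := H)) n) := by
  intro n r
  exact congrArg ModuleCat.Hom.hom (twFullIso_inv_comulPHom bb tr wa n r)
end
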